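/- Assume G ≅ C_{n1} ⊕ … ⊕ C_{nr} with 1 < n1 | … | nr and D(G) ≥ 4, and let G' be a finite abelian group with 𝓛(G) = 𝓛(G'). If ⌊nr/2⌋ + 1 ≤ r ≤ nr − 3, then exp(G) = exp(G') and r(G) = r(G'). -/

import Mathlib

/- Common definitions: zero-sum sequences over a finite abelian group,
   sets of lengths, the system of sets of lengths, the Davenport constant,
   sets of distances, elasticities, AAPs, Δ₁(G), ρ(G,d,k), ρ(G,d), ρ*(G,d),
   cross numbers, K(G₀), K(G,d), LCN-sets, Δ*(G). -/

open scoped Classical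

section Defs

variable {G : Type*} [AddCommGroup G]

/-- The support of a sequence (multiset) over `G`. -/
def suppSet (A : Multiset G) : Set G := {g | g ∈ A}

/-- `A` is a minimal zero-sum sequence (an atom of `𝓑(G₀)`) over `G₀ ⊆ G`:
a nontrivial zero-sum sequence with terms in `G₀` such that every proper
nontrivial subsequence has nonzero sum. -/
def IsMinZeroSum (G0 : Set G) (A : Multiset G) : Prop :=
  A ≠ 0 ∧ (∀ g ∈ A, g ∈ G0) ∧ A.sum = 0 ∧
    ∀ T : Multiset G, T ≤ A → T.sum = 0 → T = 0 ∨ T = A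

/-- `B` is a zero-sum sequence over `G₀ ⊆ G` (an element of `𝓑(G₀)`). -/
def IsZeroSumSeq (G0 : Set G) (B : Multiset G) : Prop :=
  (∀ g ∈ B, g ∈ G0) ∧ B.sum = 0

/-- The set of lengths `L(B)` of a zero-sum sequence `B` over `G₀`:
all `k` such that `B` is a product of `k` atoms of `𝓑(G₀)`.
(For the trivial sequence this is `{0}`.) -/
def lengthSet (G0 : Set G) (B : Multiset G) : Set ℕ :=
  {k | ∃ U : Fin k → Multiset G, (∀ i, IsMinZeroSum G0 (U i)) ∧ B = ∑ i, U i}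

/-- The system of sets of lengths `𝓛(G₀)`. -/
def systemL (G0 : Set G) : Set (Set ℕ) :=
  {L | ∃ B : Multiset G, IsZeroSumSeq G0 B ∧ L = lengthSet G0 B}

/-- The Davenport constant `D(G)`: the maximal length of a minimal zero-sum
sequence over `G`. -/
noncomputable def davenport (G : Type*) [AddCommGroup G] : ℕ :=
  sSup {m | ∃ A : Multiset G, IsMinZeroSum (Set.univ : Set G) A ∧ Multiset.card A = m}

/-- The set of successive distances `Δ(L)` of a set `L ⊆ ℕ`. -/
def deltaOf (L : Set ℕ) : Set ℕ :=
  {d | 0 < d ∧ ∃ a, a ∈ L ∧ a + d ∈ L ∧ ∀ c ∈ L, ¬(a < c ∧ c < a + d)}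

/-- `Δ(G₀) = ⋃_{L ∈ 𝓛(G₀)} Δ(L)`. -/
def deltaG0 (G0 : Set G) : Set ℕ := ⋃ L ∈ systemL G0, deltaOf L

/-- `Δ*(G) = {min Δ(G₀) : G₀ ⊆ G with Δ(G₀) ≠ ∅}`. -/
def deltaStar (G : Type*) [AddCommGroup G] : Set ℕ :=
  {d | ∃ G0 : Set G, deltaG0 G0 ≠ ∅ ∧ d = sInf (deltaG0 G0)}

/-- The elasticity `ρ(L) = max L / min L` of a (finite) set `L ⊆ ℕ`,
with the convention `ρ({0}) = 1`. -/
noncomputable def rhoL (L : Set ℕ) : ℝ :=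
  if sInf L = 0 then 1 else ((sSup L : ℕ) : ℝ) / ((sInf L : ℕ) : ℝ)

/-- The elasticity `ρ(G₀) = sup {ρ(L) : L ∈ 𝓛(G₀)}`. -/
noncomputable def rhoG0 (G0 : Set G) : ℝ := sSup (rhoL '' systemL G0)

/-- `L` (a set of naturals) is an almost arithmetical progression (AAP)
with difference `d`, length `ℓ` and bound `M`:
`L = y + (L' ∪ {0, d, …, ℓd} ∪ L'') ⊆ y + dℤ` with `L' ⊆ [−M, −1]` and
`L'' ⊆ ℓd + [1, M]`. -/
def IsAAP (L : Set ℕ) (d ℓ M : ℕ) : Prop :=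
  ∃ (y : ℤ) (L1 L2 : Set ℤ),
    L1 ⊆ Set.Icc (-(M : ℤ)) (-1) ∧
    L2 ⊆ Set.Icc ((ℓ : ℤ) * d + 1) ((ℓ : ℤ) * d + M) ∧
    ((fun x : ℕ => (x : ℤ)) '' L) =
      (fun x => y + x) '' (L1 ∪ (fun i : ℤ => (d : ℤ) * i) '' Set.Icc (0 : ℤ) (ℓ : ℤ) ∪ L2) ∧
    (∀ x ∈ L, (d : ℤ) ∣ ((x : ℤ) - y))

/-- `Δ₁(G)`: the set of `d ∈ ℕ` such that for every `k` there is some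
`L ∈ 𝓛(G)` which is an AAP with difference `d` and length at least `k`. -/
def delta1 (G : Type*) [AddCommGroup G] : Set ℕ :=
  {d | 0 < d ∧ ∀ k : ℕ, ∃ L ∈ systemL (Set.univ : Set G), ∃ ℓ ≥ k, ∃ M : ℕ, IsAAP L d ℓ M}

/-- `ρ(G, d, k)`: the supremum of elasticities of sets of lengths of `G` which
are AAPs with difference `d` and length at least `k`. -/
noncomputable def rhoGdk (G : Type*) [AddCommGroup G] (d k : ℕ) : ℝ :=
  sSup (rhoL '' {L | L ∈ systemL (Set.univ : Set G) ∧ ∃ ℓ ≥ k, ∃ M : ℕ, IsAAP L d ℓ M})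

/-- `ρ(G, d)`: the limit of the decreasing sequence `(ρ(G, d, k))_k`,
i.e. its infimum. -/
noncomputable def rhoGd (G : Type*) [AddCommGroup G] (d : ℕ) : ℝ :=
  ⨅ k : ℕ, rhoGdk G d k

/-- `ρ*(G, d) = max {ρ(G₀) : G₀ ⊆ G non-half-factorial with d ∣ min Δ(G₀)}`. -/
noncomputable def rhoStar (G : Type*) [AddCommGroup G] (d : ℕ) : ℝ :=
  sSup {x | ∃ G0 : Set G, deltaG0 G0 ≠ ∅ ∧ d ∣ sInf (deltaG0 G0) ∧ x = rhoG0 G0}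

/-- The cross number `k(S) = Σ_{g ∈ S} 1/ord(g)` of a sequence `S`. -/
noncomputable def crossNum (S : Multiset G) : ℝ :=
  (S.map (fun g => (1 : ℝ) / (addOrderOf g))).sum

/-- `K(G₀) = max {k(A) : A ∈ 𝓐(G₀)}`, the cross number of `G₀`. -/
noncomputable def KG0 (G0 : Set G) : ℝ :=
  sSup {x | ∃ A : Multiset G, IsMinZeroSum G0 A ∧ x = crossNum A}

/-- `K(G, d) = max {K(G₀) : G₀ ⊆ G non-half-factorial with d ∣ min Δ(G₀)}`. -/
noncomputable def KGd (G : Type*) [AddCommGroup G] (d : ℕ) : ℝ :=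
  sSup {x | ∃ G0 : Set G, deltaG0 G0 ≠ ∅ ∧ d ∣ sInf (deltaG0 G0) ∧ x = KG0 G0}

/-- `G₀` is an LCN-set: `k(A) ≥ 1` for every atom `A` of `𝓑(G₀)`. -/
def IsLCN (G0 : Set G) : Prop :=
  ∀ A : Multiset G, IsMinZeroSum G0 A → 1 ≤ crossNum A

end Defs


/-! ### Basic facts on atoms -/

section Basics

variable {G : Type*} [AddCommGroup G]

/-- An atom over the finite set `F`. -/
def AtF (F : Finset G) (U : Multiset G) : Prop :=
  IsMinZeroSum (Set.univ : Set G) U ∧ ∀ g ∈ U, g ∈ F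

/-- The sequence `g ^ ord g`. -/
noncomputable def OrdSeq (g : G) : Multiset G := Multiset.replicate (addOrderOf g) g

/-- `exp(G)` times the cross number. -/
noncomputable def kap (S : Multiset G) : ℕ :=
  (S.map (fun g => AddMonoid.exponent G / addOrderOf g)).sum

/-- All factorization lengths over `F` are congruent modulo `d`. -/
def PD (d : ℕ) (F : Finset G) : Prop :=
  ∀ s s' : Multiset (Multiset G), (∀ U ∈ s, AtF F U) → (∀ U ∈ s', AtF F U) →
    s.sum = s'.sum → s.card ≡ s'.card [MOD d]

lemma kap_zero : kap (0 : Multiset G) = 0 := by simp [kap]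

lemma kap_add (S T : Multiset G) : kap (S + T) = kap S + kap T := by simp [kap]

lemma kap_nsmul (n : ℕ) (S : Multiset G) : kap (n • S) = n * kap S := by
  simp [kap, Multiset.map_nsmul, Multiset.sum_nsmul]

lemma kap_sum (s : Multiset (Multiset G)) : kap s.sum = (s.map kap).sum := by
  induction s using Multiset.induction_on with
  | empty => simp [kap_zero]
  | cons a s ih => simp [kap_add, ih]

lemma sum_msum (s : Multiset (Multiset G)) (h : ∀ U ∈ s, U.sum = 0) : s.sum.sum = 0 := by
  induction s using Multiset.induction_on with
  | empty => simp
  | cons a s ih =>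
    have h1 := h a (by simp)
    have h2 := ih (fun U hU => h U (by simp [hU]))
    simp [h1, h2]

lemma sum_sub_zero {A B : Multiset G} (h : A ≤ B) (hA : A.sum = 0) (hB : B.sum = 0) :
    (B - A).sum = 0 := by
  have h1 : (B - A) + A = B := tsub_add_cancel_of_le h
  have h2 := congrArg Multiset.sum h1
  rw [Multiset.sum_add, hA, hB, add_zero] at h2
  exact h2

lemma exists_fac (F : Finset G) : ∀ (n : ℕ) (C : Multiset G), C.card = n → C.sum = 0 →
    (∀ g ∈ C, g ∈ F) → ∃ s : Multiset (Multiset G), (∀ U ∈ s, AtF F U) ∧ s.sum = C := by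
  intro n
  induction n using Nat.strong_induction_on with
  | _ n ih =>
    intro C hC h0 hF
    by_cases hz : C = 0
    · exact ⟨0, by simp, by simp [hz]⟩
    by_cases hat : IsMinZeroSum (Set.univ : Set G) C
    · refine ⟨{C}, ?_, by simp⟩
      intro U hU
      rw [Multiset.mem_singleton] at hU
      subst hU
      exact ⟨hat, hF⟩
    · have : ∃ T : Multiset G, T ≤ C ∧ T.sum = 0 ∧ T ≠ 0 ∧ T ≠ C := by
        by_contra hcon
        push Not at hcon
        apply hat
        refine ⟨hz, fun _ _ => Set.mem_univ _, h0, fun T hT hT0 => ?_⟩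
        by_cases h : T = 0
        · exact Or.inl h
        · exact Or.inr (hcon T hT hT0 h)
      obtain ⟨T, hT, hT0, hTz, hTC⟩ := this
      have hlt : T.card < C.card := by
        rcases Nat.lt_or_ge T.card C.card with h | h
        · exact h
        · exact absurd (Multiset.eq_of_le_of_card_le hT h) hTC
      have hpos : 0 < T.card := Multiset.card_pos.mpr hTz
      have hcs : (C - T).card = C.card - T.card := Multiset.card_sub hT
      obtain ⟨s1, h1, h1'⟩ := ih T.card (by omega) T rfl hT0
        (fun g hg => hF g (Multiset.mem_of_le hT hg))
      obtain ⟨s2, h2, h2'⟩ := ih (C - T).card (by omega) (C - T) rfl (sum_sub_zero hT hT0 h0)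
        (fun g hg => hF g (Multiset.mem_of_le (Multiset.sub_le_self _ _) hg))
      refine ⟨s1 + s2, ?_, ?_⟩
      · intro U hU
        rcases Multiset.mem_add.mp hU with h | h
        · exact h1 U h
        · exact h2 U h
      · rw [Multiset.sum_add, h1', h2']
        exact add_tsub_cancel_of_le hT

lemma fac_exists {F : Finset G} {C : Multiset G} (h0 : C.sum = 0) (hF : ∀ g ∈ C, g ∈ F) :
    ∃ s : Multiset (Multiset G), (∀ U ∈ s, AtF F U) ∧ s.sum = C :=
  exists_fac F _ C rfl h0 hF

lemma le_msum {s : Multiset (Multiset G)} {U : Multiset G} (h : U ∈ s) : U ≤ s.sum :=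
  Multiset.le_sum_of_mem h

/-- If a sum of atoms is an atom, there is just one summand. -/
lemma card_one_of_sum_atom {s : Multiset (Multiset G)} {B : Multiset G}
    (hs : ∀ U ∈ s, IsMinZeroSum (Set.univ : Set G) U) (hB : IsMinZeroSum (Set.univ : Set G) B)
    (h : s.sum = B) : s = {B} := by
  have hne : s ≠ 0 := by
    rintro rfl
    exact hB.1 (by simpa using h.symm)
  obtain ⟨U, hU⟩ := Multiset.exists_mem_of_ne_zero hne
  obtain ⟨t, rfl⟩ := Multiset.exists_cons_of_mem hU
  have hUB : U ≤ B := h ▸ le_msum hU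
  rcases hB.2.2.2 U hUB (hs U hU).2.2.1 with h1 | h1
  · exact absurd h1 (hs U hU).1
  · subst h1
    have ht : t.sum = 0 := by simpa using h
    by_cases htz : t = 0
    · simp [htz]
    · obtain ⟨V, hV⟩ := Multiset.exists_mem_of_ne_zero htz
      have : V ≤ 0 := ht ▸ le_msum hV
      exact absurd (Multiset.le_zero.mp this) (hs V (by simp [hV])).1

lemma atom_self {U V : Multiset G} (hU : IsMinZeroSum (Set.univ : Set G) U)
    (hV0 : V.sum = 0) (hVz : V ≠ 0) (h : V ≤ U) : V = U := by
  rcases hU.2.2.2 V h hV0 with h1 | h1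
  · exact absurd h1 hVz
  · exact h1

/-- Covering lemma. -/
lemma cover (s : Multiset (Multiset G)) : ∀ B : Multiset G, B ≤ s.sum →
    ∃ w ≤ s, B ≤ w.sum ∧ w.card ≤ B.card := by
  induction s using Multiset.induction_on with
  | empty => intro B hB; exact ⟨0, le_rfl, by simpa using hB, by simp⟩
  | cons U s ih =>
    intro B hB
    rw [Multiset.sum_cons] at hB
    have h1 : B - U ≤ s.sum := by
      rw [tsub_le_iff_left]; exact hB
    obtain ⟨w, hw, hBw, hc⟩ := ih (B - U) h1
    by_cases h : B - U = B
    · rw [h] at hBw hc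
      exact ⟨w, hw.trans (Multiset.le_cons_self _ _), hBw, hc⟩
    · refine ⟨U ::ₘ w, Multiset.cons_le_cons _ hw, ?_, ?_⟩
      · rw [Multiset.sum_cons, ← tsub_le_iff_left]; exact hBw
      · have : (B - U).card < B.card := by
          rcases Nat.lt_or_ge (B - U).card B.card with h' | h'
          · exact h'
          · exact absurd (Multiset.eq_of_le_of_card_le (Multiset.sub_le_self _ _) h') h
        rw [Multiset.card_cons]; omega

section Fin
variable [Finite G]

lemma ord_pos (g : G) : 0 < addOrderOf g := addOrderOf_pos g

lemma exp_pos' : 0 < AddMonoid.exponent G := by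
  exact Nat.pos_of_ne_zero AddMonoid.exponent_ne_zero_of_finite

lemma ord_mul (g : G) : addOrderOf g * (AddMonoid.exponent G / addOrderOf g)
    = AddMonoid.exponent G := Nat.mul_div_cancel' (AddMonoid.addOrder_dvd_exponent g)

lemma ord_le (g : G) : addOrderOf g ≤ AddMonoid.exponent G :=
  Nat.le_of_dvd exp_pos' (AddMonoid.addOrder_dvd_exponent g)

lemma quot_pos (g : G) : 1 ≤ AddMonoid.exponent G / addOrderOf g :=
  Nat.div_pos (ord_le g) (ord_pos g)

lemma kap_rep (g : G) : kap (OrdSeq g) = AddMonoid.exponent G := by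
  simp only [kap, OrdSeq, Multiset.map_replicate, Multiset.sum_replicate, smul_eq_mul]
  exact ord_mul g

lemma card_le_kap (S : Multiset G) : S.card ≤ kap S := by
  induction S using Multiset.induction_on with
  | empty => simp
  | cons a s ih =>
    have := quot_pos a
    simp only [kap, Multiset.map_cons, Multiset.sum_cons, Multiset.card_cons] at ih ⊢
    omega

lemma kap_le (S : Multiset G) : kap S ≤ AddMonoid.exponent G * S.card := by
  induction S using Multiset.induction_on with
  | empty => simp [kap]
  | cons a s ih =>
    have : AddMonoid.exponent G / addOrderOf a ≤ AddMonoid.exponent G := Nat.div_le_self _ _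
    simp only [kap, Multiset.map_cons, Multiset.sum_cons, Multiset.card_cons] at ih ⊢
    rw [mul_add]; omega

lemma rep_sum (g : G) : (OrdSeq g).sum = 0 := by
  simp [OrdSeq, addOrderOf_nsmul_eq_zero]

lemma rep_ne (g : G) : OrdSeq g ≠ 0 := by
  intro h
  have := congrArg Multiset.card h
  simp only [OrdSeq, Multiset.card_replicate, Multiset.card_zero] at this
  have := ord_pos g
  omega

lemma mem_rep {g x : G} : x ∈ OrdSeq g ↔ x = g := by
  rw [OrdSeq, Multiset.mem_replicate]
  exact ⟨fun h => h.2, fun h => ⟨(ord_pos g).ne', h⟩⟩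

lemma rep_atom (g : G) : IsMinZeroSum (Set.univ : Set G) (OrdSeq g) := by
  refine ⟨rep_ne g, fun _ _ => Set.mem_univ _, rep_sum g, fun T hT hT0 => ?_⟩
  obtain ⟨j, hj, rfl⟩ := Multiset.le_replicate_iff.mp hT
  rw [Multiset.sum_replicate] at hT0
  have := addOrderOf_dvd_of_nsmul_eq_zero hT0
  rcases Nat.eq_zero_or_pos j with h | h
  · left; simp [h]
  · right
    have := Nat.le_of_dvd h this
    have : j = addOrderOf g := le_antisymm hj this
    rw [OrdSeq, this]

lemma rep_atF {F : Finset G} {g : G} (hg : g ∈ F) : AtF F (OrdSeq g) :=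
  ⟨rep_atom g, fun x hx => by rw [mem_rep.mp hx]; exact hg⟩

lemma rep_le_iff {g : G} {S : Multiset G} : OrdSeq g ≤ S ↔ addOrderOf g ≤ S.count g := by
  rw [OrdSeq, Multiset.le_count_iff_replicate_le]

lemma atom_eq_rep {U : Multiset G} (hU : IsMinZeroSum (Set.univ : Set G) U) {g : G}
    (h : addOrderOf g ≤ U.count g) : U = OrdSeq g :=
  (atom_self hU (rep_sum g) (rep_ne g) (rep_le_iff.mpr h)).symm

lemma atom_count_le {U : Multiset G} (hU : IsMinZeroSum (Set.univ : Set G) U) (g : G) :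
    U.count g ≤ addOrderOf g := by
  by_contra h
  push Not at h
  have := atom_eq_rep hU h.le
  rw [this, OrdSeq, Multiset.count_replicate_self] at h
  omega

/-- `m • B` is a sum of sequences `OrdSeq g`. -/
lemma exp_smul_eq (B : Multiset G) : ∃ Y : Multiset G, (∀ g ∈ Y, g ∈ B) ∧ Y.card = kap B ∧
    AddMonoid.exponent G • B = (Y.map OrdSeq).sum := by
  induction B using Multiset.induction_on with
  | empty => exact ⟨0, by simp, by simp [kap], by simp⟩
  | cons a s ih =>
    obtain ⟨Y, h1, h2, h3⟩ := ih
    refine ⟨Multiset.replicate (AddMonoid.exponent G / addOrderOf a) a + Y, ?_, ?_, ?_⟩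
    · intro g hg
      rcases Multiset.mem_add.mp hg with h | h
      · rw [Multiset.eq_of_mem_replicate h]; simp
      · exact Multiset.mem_cons_of_mem (h1 g h)
    · rw [Multiset.card_add, Multiset.card_replicate, h2]; simp [kap]
    · rw [Multiset.map_add, Multiset.sum_add, ← h3, Multiset.map_replicate,
        Multiset.sum_replicate, ← Multiset.singleton_add, nsmul_add]
      congr 1
      rw [OrdSeq, Multiset.nsmul_singleton, Multiset.nsmul_replicate, mul_comm, ord_mul]

lemma atom_kap_ne_one (hm : 1 < AddMonoid.exponent G) {U : Multiset G}
    (hU : IsMinZeroSum (Set.univ : Set G) U) : 2 ≤ kap U := by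
  have h1 := card_le_kap U
  have h2 : 0 < U.card := Multiset.card_pos.mpr hU.1
  by_contra h
  have h3 : U.card = 1 := by omega
  obtain ⟨g, rfl⟩ := Multiset.card_eq_one.mp h3
  have h4 := hU.2.2.1
  rw [Multiset.sum_singleton] at h4
  subst h4
  simp [kap] at h
  omega

end Fin
end Basics

/-! ### Atoms with small cross number -/

section StepOne

variable {G : Type*} [AddCommGroup G] [Finite G]

lemma mod_gap {a b d : ℕ} (h : a ≡ b [MOD d]) (hlt : b < a) : b + d ≤ a := by
  have h1 : d ∣ a - b := (Nat.modEq_iff_dvd' hlt.le).mp h.symm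
  have := Nat.le_of_dvd (by omega) h1
  omega

lemma sum_zero_fac {s : Multiset (Multiset G)}
    (hs : ∀ U ∈ s, IsMinZeroSum (Set.univ : Set G) U) (h : s.sum = 0) : s = 0 := by
  by_contra hne
  obtain ⟨V, hV⟩ := Multiset.exists_mem_of_ne_zero hne
  have : V ≤ 0 := h ▸ le_msum hV
  exact (hs V hV).1 (Multiset.le_zero.mp this)

lemma kap_ge {q : ℕ} {s : Multiset (Multiset G)} (h : ∀ U ∈ s, q ≤ kap U) :
    q * s.card ≤ kap s.sum := by
  rw [kap_sum]
  induction s using Multiset.induction_on with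
  | empty => simp
  | cons a s ih =>
    have h1 := h a (by simp)
    have h2 := ih (fun U hU => h U (by simp [hU]))
    simp only [Multiset.map_cons, Multiset.sum_cons, Multiset.card_cons]
    rw [mul_add]; omega

lemma step1a {d : ℕ} (hm1 : 1 < AddMonoid.exponent G)
    (hm : AddMonoid.exponent G ≤ 2 * d + 1) {F : Finset G} (hPD : PD d F) {B : Multiset G}
    (hB : AtF F B) (hk : kap B < AddMonoid.exponent G) : kap B + d = AddMonoid.exponent G := by
  obtain ⟨Y, h1, h2, h3⟩ := exp_smul_eq B
  have := hPD (Multiset.replicate (AddMonoid.exponent G) B) (Y.map OrdSeq) ?_ ?_ ?_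
  · rw [Multiset.card_replicate, Multiset.card_map, h2] at this
    have h4 : d ∣ AddMonoid.exponent G - kap B := (Nat.modEq_iff_dvd' hk.le).mp this.symm
    have h5 := atom_kap_ne_one hm1 hB.1
    obtain ⟨c, hc⟩ := h4
    have : c = 1 := by
      have : c ≠ 0 := by rintro rfl; omega
      by_contra h
      have : 2 ≤ c := by omega
      have := Nat.mul_le_mul_left d this
      omega
    subst this
    omega
  · intro U hU; rw [Multiset.eq_of_mem_replicate hU]; exact hB
  · intro U hU
    obtain ⟨g, hg, rfl⟩ := Multiset.mem_map.mp hU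
    exact rep_atF (hB.2 g (h1 g hg))
  · rw [Multiset.sum_replicate, h3]

lemma step1b {d : ℕ} {F : Finset G} (hPD : PD d F) {B : Multiset G}
    (hB : AtF F B) (hk : kap B ≤ d + 1) : ∀ (i : ℕ) (s : Multiset (Multiset G)),
    (∀ U ∈ s, AtF F U) → s.sum = i • B → s.card ≤ i := by
  intro i
  induction i with
  | zero =>
    intro s hs h
    rw [sum_zero_fac (fun U hU => (hs U hU).1) (by simpa using h)]
    simp
  | succ i ih =>
    intro s hs h
    have hle : B ≤ s.sum := by rw [h, succ_nsmul]; exact Multiset.le_add_left _ _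
    obtain ⟨w, hw, hBw, hc⟩ := cover s B hle
    have hcB := card_le_kap B
    have hwF : ∀ U ∈ w, AtF F U := fun U hU => hs U (Multiset.mem_of_le hw hU)
    have hw0 : w.sum.sum = 0 := sum_msum w (fun U hU => (hwF U hU).1.2.2.1)
    obtain ⟨z, hz, hzs⟩ := fac_exists (F := F) (C := w.sum - B)
      (sum_sub_zero hBw hB.1.2.2.1 hw0) (by
        intro g hg
        have := Multiset.mem_of_le (Multiset.sub_le_self _ _) hg
        obtain ⟨U, hU, hgU⟩ := Multiset.mem_join.mp this
        exact (hwF U hU).2 g hgU)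
    have hzw : z.sum + B = w.sum := by rw [hzs]; exact tsub_add_cancel_of_le hBw
    have hsw : (s - w) + w = s := tsub_add_cancel_of_le hw
    have h1 : ((s - w) + z).card ≤ i := by
      apply ih
      · intro U hU
        rcases Multiset.mem_add.mp hU with h' | h'
        · exact hs U (Multiset.mem_of_le (Multiset.sub_le_self _ _) h')
        · exact hz U h'
      · have h2 : (s - w).sum + w.sum = (i + 1) • B := by
          rw [← h, ← Multiset.sum_add, hsw]
        rw [← hzw, succ_nsmul, ← add_assoc] at h2
        rw [Multiset.sum_add]
        exact add_right_cancel h2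
    have h3 : w.card ≡ (B ::ₘ z).card [MOD d] := by
      apply hPD _ _ hwF
      · intro U hU
        rcases Multiset.mem_cons.mp hU with h' | h'
        · rw [h']; exact hB
        · exact hz U h'
      · rw [Multiset.sum_cons, ← hzw, add_comm]
    rw [Multiset.card_cons] at h3
    have h4 := congrArg Multiset.card hsw
    rw [Multiset.card_add] at h1 h4
    have h5 : w.card ≤ z.card + 1 := by
      by_cases hz0 : z = 0
      · subst hz0
        have : w = {B} := card_one_of_sum_atom (fun U hU => (hwF U hU).1) hB.1
          (by rw [← hzw]; simp)
        simp [this]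
      · have : 0 < z.card := Multiset.card_pos.mpr hz0
        by_contra hcon
        have := mod_gap h3 (by omega)
        omega
    omega

lemma step1 {d : ℕ} (hd : 1 ≤ d) (hm1 : 1 < AddMonoid.exponent G)
    (hm : AddMonoid.exponent G ≤ 2 * d + 1) {F : Finset G} (hPD : PD d F) {B : Multiset G}
    (hB : AtF F B) (hk : kap B < AddMonoid.exponent G) : B.Nodup := by
  have hkB := step1a hm1 hm hPD hB hk
  have hall : ∀ U, AtF F U → kap B ≤ kap U := by
    intro U hU
    rcases Nat.lt_or_ge (kap U) (AddMonoid.exponent G) with h | h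
    · have := step1a hm1 hm hPD hU h
      omega
    · omega
  have key : ∀ (x : ℕ) (g : G), g ∈ B → addOrderOf g ≤ x * B.count g →
      ∃ z : Multiset (Multiset G), z.card + 1 ≤ x ∧ z.card + 1 ≡ x [MOD d] ∧
      kap B * z.card + AddMonoid.exponent G ≤ x * kap B ∧
      (addOrderOf g < x * B.count g → z ≠ 0) := by
    intro x g hg hx
    have hle : OrdSeq g ≤ x • B := by
      rw [rep_le_iff, Multiset.count_nsmul]; exact hx
    have hxF : ∀ y ∈ x • B, y ∈ F := fun y hy => hB.2 y (Multiset.mem_of_mem_nsmul hy)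
    obtain ⟨z, hz, hzs⟩ := fac_exists (F := F) (C := x • B - OrdSeq g)
      (sum_sub_zero hle (rep_sum g) (by rw [Multiset.sum_nsmul, hB.1.2.2.1, smul_zero]))
      (fun y hy => hxF y (Multiset.mem_of_le (Multiset.sub_le_self _ _) hy))
    have h1 : z.sum + OrdSeq g = x • B := by rw [hzs]; exact tsub_add_cancel_of_le hle
    have h2 : ∀ U ∈ OrdSeq g ::ₘ z, AtF F U := by
      intro U hU
      rcases Multiset.mem_cons.mp hU with h' | h'
      · rw [h']; exact rep_atF (hB.2 g hg)
      · exact hz U h'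
    have h3 : (OrdSeq g ::ₘ z).sum = x • B := by rw [Multiset.sum_cons, add_comm, h1]
    refine ⟨z, ?_, ?_, ?_, ?_⟩
    · have := step1b hPD hB (by omega) x _ h2 h3
      simpa using this
    · have := hPD (OrdSeq g ::ₘ z) (Multiset.replicate x B) h2 ?_ ?_
      · simpa using this
      · intro U hU; rw [Multiset.eq_of_mem_replicate hU]; exact hB
      · rw [h3, Multiset.sum_replicate]
    · have h4 := kap_ge (q := kap B) (s := z) (fun U hU => hall U (hz U hU))
      have h5 := congrArg kap h1
      rw [kap_add, kap_rep, kap_nsmul] at h5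
      omega
    · rintro hlt rfl
      have h5 := congrArg (Multiset.count g) h1
      rw [Multiset.count_nsmul] at h5
      simp [OrdSeq] at h5
      omega
  rw [Multiset.nodup_iff_count_le_one]
  intro g
  by_cases hg : g ∈ B
  swap
  · rw [Multiset.count_eq_zero_of_notMem hg]; omega
  have hlt : d * B.count g < addOrderOf g := by
    by_contra hcon
    push Not at hcon
    obtain ⟨z, h1, h2, h3, -⟩ := key d g hg hcon
    have h4 : z.card + 1 = d := by
      rcases Nat.lt_or_ge (z.card + 1) d with h | h
      · have := mod_gap h2.symm h
        omega
      · omega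
    rw [← h4] at h3
    rw [add_mul, one_mul, mul_comm (kap B)] at h3
    omega
  by_contra hcon
  push Not at hcon
  have ho := ord_le g
  have hb : B.count g = 2 := by
    by_contra h
    have : 3 ≤ B.count g := by omega
    nlinarith [Nat.mul_le_mul_left d this]
  rw [hb] at hlt
  have hmm : AddMonoid.exponent G = 2 * d + 1 := by omega
  obtain ⟨z, h1, h2, h3, h4⟩ := key (d + 1) g hg (by rw [hb]; omega)
  have hz : 0 < z.card := Multiset.card_pos.mpr (h4 (by rw [hb]; omega))
  have h5 : z.card = d := by
    rcases Nat.lt_or_ge (z.card + 1) (d + 1) with h | h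
    · have := mod_gap h2.symm h
      omega
    · omega
  rw [h5, hmm] at h3
  have : kap B = d + 1 := by omega
  rw [this] at h3
  nlinarith

end StepOne

/-! ### Rank and relations -/

section Relations

variable {G : Type*} [AddCommGroup G] [Finite G]

/-- All `p`-ranks are at most `r`. -/
def RkLe (G : Type*) [AddCommGroup G] (r : ℕ) : Prop :=
  ∀ p : ℕ, p.Prime → Nat.card {x : G // p • x = 0} ≤ p ^ r

lemma index_le {r p : ℕ} (hr : RkLe G r) (hp : p.Prime) (M : AddSubgroup G) :
    Nat.card (M ⧸ (nsmulAddMonoidHom p : M →+ M).range) ≤ p ^ r := by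
  set φ : M →+ M := nsmulAddMonoidHom p with hφ
  have h1 := AddSubgroup.card_eq_card_quotient_mul_card_addSubgroup φ.range
  have h2 := AddSubgroup.card_eq_card_quotient_mul_card_addSubgroup φ.ker
  have h3 : Nat.card (M ⧸ φ.ker) = Nat.card φ.range :=
    Nat.card_congr (QuotientAddGroup.quotientKerEquivRange φ).toEquiv
  have h4 : 0 < Nat.card φ.range := Nat.card_pos
  have h5 : Nat.card (M ⧸ φ.range) = Nat.card φ.ker := by
    rw [h3] at h2
    have : Nat.card φ.range * Nat.card (M ⧸ φ.range) = Nat.card φ.range * Nat.card φ.ker := by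
      rw [← h2, mul_comm, ← h1]
    exact Nat.eq_of_mul_eq_mul_left h4 this
  rw [h5]
  refine le_trans ?_ (hr p hp)
  refine Nat.card_le_card_of_injective
    (fun x : φ.ker => (⟨((x : M) : G), ?_⟩ : {x : G // p • x = 0})) ?_
  · have := x.2
    rw [AddMonoidHom.mem_ker] at this
    have h := congrArg (fun y : M => (y : G)) this
    simpa [hφ] using h
  · intro x y h
    apply Subtype.ext
    apply Subtype.ext
    simpa using h

lemma exists_relation {r p : ℕ} (hr : RkLe G r) (hp : p.Prime) (E : Finset G)
    (hE : r < E.card) : ∃ c : G → ℤ, ∑ g ∈ E, c g • g = 0 ∧ ∃ g' ∈ E, ¬ (p : ℤ) ∣ c g' := by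
  let Φ : (E → ℤ) →+ G := AddMonoidHom.mk' (fun c => ∑ g : E, c g • (g : G)) (by
    intro a b
    simp [add_smul, Finset.sum_add_distrib])
  let M := Φ.range
  have hidx := index_le hr hp M
  let f : (E → Fin p) → M ⧸ (nsmulAddMonoidHom p : M →+ M).range := fun a =>
    QuotientAddGroup.mk ⟨Φ (fun g => ((a g : ℕ) : ℤ)), ⟨_, rfl⟩⟩
  have hninj : ¬ Function.Injective f := by
    intro hinj
    have h1 := Nat.card_le_card_of_injective f hinj
    have h2 : Nat.card (E → Fin p) = p ^ E.card := by
      simp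
    rw [h2] at h1
    have h3 : p ^ r < p ^ E.card := Nat.pow_lt_pow_right hp.one_lt hE
    omega
  rw [Function.not_injective_iff] at hninj
  obtain ⟨a, b, hab, hne⟩ := hninj
  obtain ⟨g', hg'⟩ := Function.ne_iff.mp hne
  have h1 := QuotientAddGroup.eq.mp hab
  obtain ⟨⟨y, e, he⟩, hy⟩ := h1
  have h2 := congrArg (fun y : M => (y : G)) hy
  simp only [nsmulAddMonoidHom_apply, AddSubgroup.coe_nsmul, AddSubgroup.coe_add,
    AddSubgroup.coe_neg] at h2
  let c : E → ℤ := (p : ℕ) • e + (fun g => ((a g : ℕ) : ℤ)) - (fun g => ((b g : ℕ) : ℤ))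
  have hc : Φ c = 0 := by
    simp only [c, map_sub, map_add, map_nsmul, he, h2]
    abel
  refine ⟨fun g => if h : g ∈ E then c ⟨g, h⟩ else 0, ?_, g'.1, g'.2, ?_⟩
  · rw [← Finset.sum_coe_sort E]
    simpa [Φ] using hc
  · simp only [g'.2, dite_true, Subtype.coe_eta]
    intro hdvd
    have h3 : (p : ℤ) ∣ ((a g' : ℕ) : ℤ) - ((b g' : ℕ) : ℤ) := by
      have : c g' = (p : ℤ) * e g' + (((a g' : ℕ) : ℤ) - ((b g' : ℕ) : ℤ)) := by
        simp [c]; ring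
      rw [this] at hdvd
      exact (Int.dvd_add_right (dvd_mul_right _ _)).mp hdvd
    have h4 := (a g').2
    have h5 := (b g').2
    have h6 : ((a g' : ℕ) : ℤ) - ((b g' : ℕ) : ℤ) = 0 :=
      Int.eq_zero_of_abs_lt_dvd h3 (by rw [abs_lt]; constructor <;> omega)
    apply hg'
    apply Fin.ext
    omega

end Relations

/-! ### Atoms with large cross number -/

section StepTwo

variable {G : Type*} [AddCommGroup G] [Finite G]

/-- `N` is a sum of atoms over `F` of cross number one. -/
def Spl (F : Finset G) (N : Multiset G) : Prop :=
  ∃ s : Multiset (Multiset G), (∀ U ∈ s, AtF F U ∧ kap U = AddMonoid.exponent G) ∧ s.sum = N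

lemma Spl.add {F : Finset G} {M N : Multiset G} (hM : Spl F M) (hN : Spl F N) :
    Spl F (M + N) := by
  obtain ⟨s, hs, rfl⟩ := hM
  obtain ⟨t, ht, rfl⟩ := hN
  refine ⟨s + t, ?_, by simp⟩
  intro U hU
  rcases Multiset.mem_add.mp hU with h | h
  · exact hs U h
  · exact ht U h

lemma Spl.zero {F : Finset G} : Spl F (0 : Multiset G) := ⟨0, by simp, by simp⟩

lemma Spl.nsmul {F : Finset G} {M : Multiset G} (hM : Spl F M) (k : ℕ) : Spl F (k • M) := by
  induction k with
  | zero => rw [zero_nsmul]; exact Spl.zero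
  | succ k ih => rw [succ_nsmul]; exact ih.add hM

lemma Spl.rep {F : Finset G} {g : G} (hg : g ∈ F) : Spl F (OrdSeq g) := by
  refine ⟨{OrdSeq g}, ?_, by simp⟩
  intro U hU
  rw [Multiset.mem_singleton] at hU
  subst hU
  exact ⟨rep_atF hg, kap_rep g⟩

lemma Spl.sum_zero {F : Finset G} {M : Multiset G} (hM : Spl F M) : M.sum = 0 := by
  obtain ⟨s, hs, rfl⟩ := hM
  exact sum_msum s (fun U hU => (hs U hU).1.1.2.2.1)

lemma mem_of_fac {F : Finset G} {s : Multiset (Multiset G)} (hs : ∀ U ∈ s, AtF F U) :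
    ∀ g ∈ s.sum, g ∈ F := by
  intro g hg
  obtain ⟨U, hU, hgU⟩ := Multiset.mem_join.mp hg
  exact (hs U hU).2 g hgU

lemma Spl.mem {F : Finset G} {M : Multiset G} (hM : Spl F M) : ∀ g ∈ M, g ∈ F := by
  obtain ⟨s, hs, rfl⟩ := hM
  exact mem_of_fac (fun U hU => (hs U hU).1)

lemma spl_of_erase {F : Finset G}
    (hprop : ∀ V, AtF F V → V.toFinset ≠ F → kap V = AddMonoid.exponent G)
    {h : G} (hh : h ∈ F) {N : Multiset G} (hN : ∀ g ∈ N, g ∈ F.erase h) (h0 : N.sum = 0) :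
    Spl F N := by
  obtain ⟨s, hs, hsum⟩ := fac_exists h0 hN
  refine ⟨s, fun U hU => ?_, hsum⟩
  have h1 : AtF F U := ⟨(hs U hU).1, fun g hg => Finset.mem_of_mem_erase ((hs U hU).2 g hg)⟩
  refine ⟨h1, hprop U h1 ?_⟩
  intro heq
  rw [← heq, Multiset.mem_toFinset] at hh
  exact Finset.notMem_erase h F ((hs U hU).2 h hh)

lemma count_fsum (F : Finset G) (f : G → ℕ) (h : G) :
    (∑ g ∈ F, Multiset.replicate (f g) g).count h = if h ∈ F then f h else 0 := by
  rw [Multiset.count_sum']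
  simp only [Multiset.count_replicate]
  rw [Finset.sum_ite_eq']

lemma mem_fsum {F : Finset G} {f : G → ℕ} {h : G}
    (hm : h ∈ ∑ g ∈ F, Multiset.replicate (f g) g) : h ∈ F := by
  rw [← Multiset.one_le_count_iff_mem, count_fsum] at hm
  by_contra hcon
  simp [hcon] at hm

lemma sum_fsum (F : Finset G) (f : G → ℕ) :
    (∑ g ∈ F, Multiset.replicate (f g) g).sum = ∑ g ∈ F, f g • g := by
  induction F using Finset.induction_on with
  | empty => simp
  | insert a s ha ih => rw [Finset.sum_insert ha, Finset.sum_insert ha, Multiset.sum_add, ih,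
      Multiset.sum_replicate]

/-- Realising an integral relation by a sequence. -/
lemma realize (F : Finset G) (b : G → ℤ) (h0 : ∑ g ∈ F, b g • g = 0) :
    ∃ Z : Multiset G, Z.sum = 0 ∧ (∀ g ∈ Z, g ∈ F) ∧
      ∀ h ∈ F, (Z.count h : ℤ) ≡ b h [ZMOD addOrderOf h] := by
  refine ⟨∑ g ∈ F, Multiset.replicate (b g % addOrderOf g).toNat g, ?_, fun g hg => mem_fsum hg,
    ?_⟩
  · rw [sum_fsum, ← h0]
    apply Finset.sum_congr rfl
    intro g _
    have h1 : (0 : ℤ) ≤ b g % addOrderOf g :=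
      Int.emod_nonneg _ (by exact_mod_cast (ord_pos g).ne')
    rw [← natCast_zsmul, Int.toNat_of_nonneg h1]
    exact mod_addOrderOf_zsmul _ _
  · intro h hh
    rw [count_fsum, if_pos hh]
    have h1 : (0 : ℤ) ≤ b h % addOrderOf h :=
      Int.emod_nonneg _ (by exact_mod_cast (ord_pos h).ne')
    rw [Int.toNat_of_nonneg h1]
    exact Int.mod_modEq _ _

lemma sum_eq_count {F : Finset G} {A : Multiset G} (hA : ∀ g ∈ A, g ∈ F) :
    ∑ g ∈ F, (A.count g : ℤ) • g = A.sum := by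
  have h1 : A = ∑ g ∈ F, Multiset.replicate (A.count g) g := by
    ext h
    rw [count_fsum]
    split_ifs with hh
    · rfl
    · exact Multiset.count_eq_zero_of_notMem (fun h' => hh (hA h h'))
  conv_rhs => rw [h1, sum_fsum]
  simp

lemma subgroup_top (J : AddSubgroup ℤ) (h : ∀ p : ℕ, p.Prime → ∃ e ∈ J, ¬ (p : ℤ) ∣ e) :
    (1 : ℤ) ∈ J := by
  obtain ⟨t, rfl⟩ := Int.subgroup_cyclic J
  by_cases ht : t.natAbs = 1
  · rw [AddSubgroup.mem_closure_singleton]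
    rcases Int.natAbs_eq_iff.mp ht with h' | h'
    · exact ⟨1, by simp [h']⟩
    · exact ⟨-1, by simp [h']⟩
  · obtain ⟨p, hp, hpt⟩ := Nat.exists_prime_and_dvd ht
    obtain ⟨e, he, hpe⟩ := h p hp
    rw [AddSubgroup.mem_closure_singleton] at he
    obtain ⟨k, rfl⟩ := he
    exact absurd (Dvd.dvd.mul_left (Int.natCast_dvd.mpr hpt) k) (by simpa using hpe)

/-- The subgroup of realisable multiplicities of `h` modulo `ord h`. -/
def multSub (F : Finset G) (h : G) : AddSubgroup ℤ where
  carrier := {x | ∃ Z : Multiset G, Spl F Z ∧ (Z.count h : ℤ) ≡ x [ZMOD addOrderOf h]}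
  zero_mem' := ⟨0, Spl.zero, by simp⟩
  add_mem' := by
    rintro x y ⟨Z, hZ, hx⟩ ⟨W, hW, hy⟩
    refine ⟨Z + W, hZ.add hW, ?_⟩
    rw [Multiset.count_add, Nat.cast_add]
    exact hx.add hy
  neg_mem' := by
    rintro x ⟨Z, hZ, hx⟩
    refine ⟨(addOrderOf h - 1) • Z, hZ.nsmul _, ?_⟩
    rw [Multiset.count_nsmul, Nat.cast_mul, Nat.cast_sub (ord_pos h)]
    have h1 : ((addOrderOf h : ℤ) - (1 : ℕ)) ≡ -1 [ZMOD addOrderOf h] := by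
      rw [Int.modEq_iff_dvd]
      exact ⟨-1, by push_cast; ring⟩
    have := h1.mul hx
    simpa using this

lemma exists_completion {d r : ℕ} (hrd : r ≤ d) (hrk : RkLe G r) {F : Finset G}
    (hprop : ∀ V, AtF F V → V.toFinset ≠ F → kap V = AddMonoid.exponent G)
    (hcard : d + 2 ≤ F.card) {A : Multiset G} (hA : ∀ g ∈ A, g ∈ F) (hA0 : A.sum = 0) :
    ∃ Z, Spl F Z ∧ Spl F (A + Z) := by
  have hne : F.Nonempty := Finset.card_pos.mp (by omega)
  obtain ⟨h, hh⟩ := hne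
  have hJ : (1 : ℤ) ∈ (multSub F h).comap (AddMonoidHom.mulRight (A.count h : ℤ)) := by
    apply subgroup_top
    intro p hp
    obtain ⟨c, hc, g', hg', hpc⟩ := exists_relation hrk hp (F.erase h)
      (by rw [Finset.card_erase_of_mem hh]; omega)
    refine ⟨c g', ?_, hpc⟩
    have hg'F := Finset.mem_of_mem_erase hg'
    have hg'h := Finset.ne_of_mem_erase hg'
    let b : G → ℤ := fun g => c g' * A.count g - A.count g' * (if g = h then 0 else c g)
    have hb1 : ∑ g ∈ F, b g • g = 0 := by
      have e1 : ∑ g ∈ F, (if g = h then 0 else c g) • g = 0 := by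
        rw [← Finset.add_sum_erase F _ hh, if_pos rfl, zero_smul, zero_add, ← hc]
        apply Finset.sum_congr rfl
        intro g hg
        rw [if_neg (Finset.ne_of_mem_erase hg)]
      have e2 := sum_eq_count hA
      rw [hA0] at e2
      simp only [b, sub_smul, mul_smul, Finset.sum_sub_distrib, ← Finset.smul_sum, e1, e2]
      simp
    have hb2 : b g' = 0 := by simp only [b, if_neg hg'h]; ring
    have hb3 : ∑ g ∈ F.erase g', b g • g = 0 := by
      rw [← Finset.add_sum_erase F _ hg'F, hb2, zero_smul, zero_add] at hb1
      exact hb1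
    obtain ⟨Z, hZ0, hZF, hZc⟩ := realize _ b hb3
    have hhe : h ∈ F.erase g' := Finset.mem_erase.mpr ⟨hg'h.symm, hh⟩
    refine ⟨Z, spl_of_erase hprop hg'F hZF hZ0, ?_⟩
    have := hZc h hhe
    simpa [b] using this
  have hJ' : -(A.count h : ℤ) ∈ multSub F h := by
    apply neg_mem
    simpa using hJ
  obtain ⟨Z, hZ, hZc⟩ := hJ'
  refine ⟨Z, hZ, ?_⟩
  have hdvd : addOrderOf h ∣ (A + Z).count h := by
    have h1 := Int.modEq_iff_dvd.mp hZc.symm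
    rw [Multiset.count_add]
    have h2 : ((addOrderOf h : ℕ) : ℤ) ∣ ((A.count h + Z.count h : ℕ) : ℤ) := by
      push_cast
      convert h1 using 1
      ring
    exact_mod_cast h2
  obtain ⟨y, hy⟩ := hdvd
  have hsplit : A + Z = y • OrdSeq h + (A + Z).filter (fun g => ¬ g = h) := by
    have hf : (A + Z).filter (fun g => g = h) = Multiset.replicate ((A + Z).count h) h := by
      convert Multiset.filter_eq' (A + Z) h
    conv_lhs => rw [← Multiset.filter_add_not (fun g => g = h) (A + Z)]
    rw [hf, OrdSeq, Multiset.nsmul_replicate, hy, mul_comm]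
  have hrep : Spl F (y • OrdSeq h) := (Spl.rep hh).nsmul y
  rw [hsplit]
  refine hrep.add (spl_of_erase hprop hh ?_ ?_)
  · intro g hg
    rw [Multiset.mem_filter] at hg
    rw [Finset.mem_erase]
    refine ⟨hg.2, ?_⟩
    rcases Multiset.mem_add.mp hg.1 with h' | h'
    · exact hA g h'
    · exact hZ.mem g h'
  · have h1 := congrArg Multiset.sum hsplit
    rw [Multiset.sum_add, Multiset.sum_add, hA0, hZ.sum_zero, hrep.sum_zero] at h1
    simpa using h1.symm

lemma first_split {F : Finset G} (Y : Multiset G) : (∀ g ∈ Y, g ∈ F) → ∀ N : Multiset G,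
    N.sum = 0 → (∀ g ∈ N, g ∈ F) → ¬ Spl F N → Spl F (N + (Y.map OrdSeq).sum) →
    ∃ N' : Multiset G, N'.sum = 0 ∧ (∀ g ∈ N', g ∈ F) ∧ ¬ Spl F N' ∧
      ∃ g ∈ F, Spl F (N' + OrdSeq g) := by
  induction Y using Multiset.induction_on with
  | empty => intro _ N _ _ h1 h2; exact absurd (by simpa using h2) h1
  | cons y Y ih =>
    intro hY N hN hNF h1 h2
    have hy : y ∈ F := hY y (by simp)
    by_cases h3 : Spl F (N + OrdSeq y)
    · exact ⟨N, hN, hNF, h1, y, hy, h3⟩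
    · refine ih (fun g hg => hY g (by simp [hg])) (N + OrdSeq y) ?_ ?_ h3 ?_
      · rw [Multiset.sum_add, hN, rep_sum, add_zero]
      · intro g hg
        rcases Multiset.mem_add.mp hg with h' | h'
        · exact hNF g h'
        · rw [mem_rep.mp h']; exact hy
      · rw [Multiset.map_cons, Multiset.sum_cons, ← add_assoc] at h2
        exact h2

lemma count_msum_ge {q : ℕ} {g : G} (s : Multiset (Multiset G)) :
    (∀ V ∈ s, q ≤ V.count g) → s.card * q ≤ s.sum.count g := by
  induction s using Multiset.induction_on with
  | empty => intro _; simp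
  | cons a s ih =>
    intro h
    have h1 := h a (by simp)
    have h2 := ih (fun V hV => h V (by simp [hV]))
    rw [Multiset.card_cons, Multiset.sum_cons, Multiset.count_add, add_mul]
    omega

lemma step2core {d r : ℕ} (hd : 1 ≤ d) (hm : AddMonoid.exponent G ≤ 2 * d + 1)
    (hrd : r ≤ d) (hrk : RkLe G r) {F : Finset G} (hPD : PD d F)
    (hge : ∀ V, AtF F V → AddMonoid.exponent G ≤ kap V)
    (hprop : ∀ V, AtF F V → V.toFinset ≠ F → kap V = AddMonoid.exponent G)
    {A : Multiset G} (hA : AtF F A) (hk : AddMonoid.exponent G < kap A) : False := by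
  have hmpos : 0 < AddMonoid.exponent G := exp_pos'
  -- the support is large
  have hcard : d + 2 ≤ F.card := by
    have hAP : A ≤ ∑ g ∈ F, OrdSeq g := by
      rw [Multiset.le_iff_count]
      intro g
      unfold OrdSeq
      rw [count_fsum]
      split_ifs with h
      · exact atom_count_le hA.1 g
      · rw [Multiset.count_eq_zero_of_notMem (fun h' => h (hA.2 g h'))]
    have hP : (∑ g ∈ F, OrdSeq g) = (F.val.map OrdSeq).sum := rfl
    have hPF : ∀ U ∈ F.val.map OrdSeq, AtF F U := by
      intro U hU
      obtain ⟨g, hg, rfl⟩ := Multiset.mem_map.mp hU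
      exact rep_atF hg
    rw [hP] at hAP
    obtain ⟨z, hz, hzs⟩ := fac_exists (F := F) (C := (F.val.map OrdSeq).sum - A)
      (sum_sub_zero hAP hA.1.2.2.1 (sum_msum _ (fun U hU => (hPF U hU).1.2.2.1)))
      (fun g hg => mem_of_fac hPF g (Multiset.mem_of_le (Multiset.sub_le_self _ _) hg))
    have h1 : z.sum + A = (F.val.map OrdSeq).sum := by
      rw [hzs]; exact tsub_add_cancel_of_le hAP
    have h2 := congrArg kap h1
    have h3 : kap (F.val.map OrdSeq).sum = AddMonoid.exponent G * F.card := by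
      rw [kap_sum, Multiset.map_map]
      have : (kap ∘ OrdSeq : G → ℕ) = fun _ => AddMonoid.exponent G := by
        funext g; exact kap_rep g
      rw [this, Multiset.map_const', Multiset.sum_replicate, smul_eq_mul, mul_comm]
      rfl
    have h4 := kap_ge (q := AddMonoid.exponent G) (s := z) (fun U hU => hge U (hz U hU))
    rw [kap_add, h3] at h2
    have h5 : z.card + 1 < F.card := by
      have : AddMonoid.exponent G * (z.card + 1) < AddMonoid.exponent G * F.card := by
        rw [mul_add]; omega
      exact lt_of_mul_lt_mul_left this (Nat.zero_le _)
    have h6 : (F.val.map OrdSeq).card ≡ (A ::ₘ z).card [MOD d] := by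
      apply hPD _ _ hPF
      · intro U hU
        rcases Multiset.mem_cons.mp hU with h' | h'
        · rw [h']; exact hA
        · exact hz U h'
      · rw [Multiset.sum_cons, add_comm, h1]
    rw [Multiset.card_map, Multiset.card_cons] at h6
    have h7 : z.card + 1 + d ≤ F.card := mod_gap h6 h5
    have h8 : z ≠ 0 := by
      rintro rfl
      obtain ⟨g, hg⟩ := Finset.card_pos.mp (show 0 < F.card by omega)
      have h9 : OrdSeq g ≤ A := by
        have : A = (F.val.map OrdSeq).sum := by simpa using h1
        rw [this]
        exact le_msum (Multiset.mem_map_of_mem _ hg)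
      have h10 := atom_self hA.1 (rep_sum g) (rep_ne g) h9
      rw [← h10, kap_rep] at hk
      omega
    have := Multiset.card_pos.mpr h8
    omega
  have hAns : ¬ Spl F A := by
    rintro ⟨s, hs, hsum⟩
    have h1 := card_one_of_sum_atom (fun U hU => (hs U hU).1.1) hA.1 hsum
    have h2 := (hs A (by simp [h1])).2
    omega
  obtain ⟨Z, hZ, hAZ⟩ := exists_completion hrd hrk hprop hcard hA.2 hA.1.2.2.1
  obtain ⟨Y, hYZ, -, hY⟩ := exp_smul_eq Z
  have hAY : Spl F (A + (Y.map OrdSeq).sum) := by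
    rw [← hY]
    obtain ⟨k, hk⟩ : ∃ k, AddMonoid.exponent G = k + 1 := ⟨AddMonoid.exponent G - 1, by omega⟩
    rw [hk, succ_nsmul', ← add_assoc]
    exact hAZ.add (hZ.nsmul k)
  have hex : ∃ n : ℕ, ∃ N' : Multiset G, N'.card = n ∧ N'.sum = 0 ∧ (∀ g ∈ N', g ∈ F) ∧
      ¬ Spl F N' ∧ ∃ g ∈ F, Spl F (N' + OrdSeq g) := by
    obtain ⟨N, h⟩ := first_split Y (fun g hg => hZ.mem g (hYZ g hg)) A hA.1.2.2.1 hA.2 hAns hAY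
    exact ⟨_, N, rfl, h⟩
  obtain ⟨N, hNc, hN0, hNF, hNs, g, hg, s, hs, hsum⟩ := Nat.find_spec hex
  have hmin := fun n => @Nat.find_min _ _ hex n
  have hV : ∀ V ∈ s, N.count g + 1 ≤ V.count g := by
    intro V hV
    by_contra hcon
    have hVle : V ≤ N := by
      rw [Multiset.le_iff_count]
      intro x
      by_cases hx : x = g
      · subst hx; omega
      · have h1 : V ≤ N + OrdSeq g := hsum ▸ le_msum hV
        have h2 := Multiset.le_iff_count.mp h1 x
        have h3 : (OrdSeq g).count x = 0 :=
          Multiset.count_eq_zero_of_notMem (fun h' => hx (mem_rep.mp h'))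
        rw [Multiset.count_add, h3] at h2
        omega
    have hVN : N - V + V = N := tsub_add_cancel_of_le hVle
    have hcV : 0 < V.card := Multiset.card_pos.mpr (hs V hV).1.1.1
    have hcN := congrArg Multiset.card hVN
    rw [Multiset.card_add] at hcN
    apply hmin (N - V).card (by omega)
    refine ⟨N - V, rfl, sum_sub_zero hVle (hs V hV).1.1.2.2.1 hN0,
      fun x hx => hNF x (Multiset.mem_of_le (Multiset.sub_le_self _ _) hx), ?_, g, hg, ?_⟩
    · intro h
      apply hNs
      rw [← hVN]
      refine h.add ⟨{V}, ?_, by simp⟩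
      intro U hU
      rw [Multiset.mem_singleton] at hU
      rw [hU]
      exact hs V hV
    · obtain ⟨t, rfl⟩ := Multiset.exists_cons_of_mem hV
      refine ⟨t, fun U hU => hs U (by simp [hU]), ?_⟩
      rw [Multiset.sum_cons, ← hVN, add_comm (N - V) V, add_assoc] at hsum
      have hsum' := add_left_cancel hsum
      rw [hsum']
  have h1 := count_msum_ge s hV
  rw [hsum, Multiset.count_add] at h1
  have h2 : (OrdSeq g).count g = addOrderOf g := by simp [OrdSeq]
  rw [h2] at h1
  obtain ⟨z, hz, hzs⟩ := fac_exists hN0 hNF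
  have hbad : ∃ V ∈ z, kap V ≠ AddMonoid.exponent G := by
    by_contra hcon
    push Not at hcon
    exact hNs ⟨z, fun U hU => ⟨hz U hU, hcon U hU⟩, hzs⟩
  obtain ⟨V, hVz, hVk⟩ := hbad
  have hVF : V.toFinset = F := by
    by_contra h
    exact hVk (hprop V (hz V hVz) h)
  have hn1 : 1 ≤ N.count g := by
    rw [Multiset.one_le_count_iff_mem]
    rw [← hVF, Multiset.mem_toFinset] at hg
    rw [← hzs]
    exact Multiset.mem_of_le (le_msum hVz) hg
  have hcong : (OrdSeq g ::ₘ z).card ≡ s.card [MOD d] := by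
    apply hPD
    · intro U hU
      rcases Multiset.mem_cons.mp hU with h' | h'
      · rw [h']; exact rep_atF hg
      · exact hz U h'
    · exact fun U hU => (hs U hU).1
    · rw [Multiset.sum_cons, hzs, hsum, add_comm]
  rw [Multiset.card_cons] at hcong
  have hks : kap s.sum = AddMonoid.exponent G * s.card := by
    rw [kap_sum, Multiset.map_congr rfl (fun U hU => (hs U hU).2), Multiset.map_const',
      Multiset.sum_replicate, smul_eq_mul, mul_comm]
  rw [hsum, kap_add, kap_rep] at hks
  obtain ⟨t, rfl⟩ := Multiset.exists_cons_of_mem hVz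
  have hVm := hge V (hz V hVz)
  have h4 := kap_ge (q := AddMonoid.exponent G) (s := t)
    (fun U hU => hge U (hz U (by simp [hU])))
  rw [← hzs, Multiset.sum_cons, kap_add] at hks
  rw [Multiset.card_cons] at hcong
  have h5 : t.card + 1 + 1 < s.card := by
    have : AddMonoid.exponent G * (t.card + 1 + 1) < AddMonoid.exponent G * s.card := by
      rw [mul_add, mul_add]; omega
    exact lt_of_mul_lt_mul_left this (Nat.zero_le _)
  have h6 := mod_gap hcong.symm h5
  have h7 : (d + 2) * (N.count g + 1) ≤ s.card * (N.count g + 1) :=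
    Nat.mul_le_mul_right _ (by omega)
  have h8 := ord_le g
  nlinarith

/-- No atom over `F₀` has cross number larger than one. -/
lemma step2 {d r : ℕ} (hd : 1 ≤ d) (hm1 : 1 < AddMonoid.exponent G)
    (hm : AddMonoid.exponent G ≤ 2 * d + 1)
    (hrd : r ≤ d) (hrk : RkLe G r) {F0 : Finset G} (hPD : PD d F0) (A : Multiset G)
    (hA : AtF F0 A) : kap A ≤ AddMonoid.exponent G := by
  by_contra hcon
  push Not at hcon
  have hex : ∃ n : ℕ, ∃ A : Multiset G, A.toFinset.card = n ∧ AtF F0 A ∧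
      AddMonoid.exponent G < kap A := ⟨_, A, rfl, hA, hcon⟩
  obtain ⟨A, hAc, hA, hk⟩ := Nat.find_spec hex
  have hmin := fun n => @Nat.find_min _ _ hex n
  have hsub : ∀ V, AtF A.toFinset V → AtF F0 V := fun V hV =>
    ⟨hV.1, fun g hg => hA.2 g (Multiset.mem_toFinset.mp (hV.2 g hg))⟩
  have hge : ∀ V, AtF A.toFinset V → AddMonoid.exponent G ≤ kap V := by
    intro V hV
    by_contra h
    push Not at h
    have hnd := step1 hd hm1 hm hPD (hsub V hV) h
    have hle : V ≤ A := by
      rw [Multiset.le_iff_subset hnd]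
      exact fun g hg => Multiset.mem_toFinset.mp (hV.2 g hg)
    have := atom_self hA.1 hV.1.2.2.1 hV.1.1 hle
    rw [this] at h
    omega
  refine step2core (F := A.toFinset) (A := A) hd hm hrd hrk ?_ hge ?_ ?_ hk
  · intro s s' hs hs' h
    exact hPD s s' (fun U hU => hsub U (hs U hU)) (fun U hU => hsub U (hs' U hU)) h
  · intro V hV hne
    apply le_antisymm _ (hge V hV)
    by_contra h
    push Not at h
    have hss : V.toFinset ⊂ A.toFinset :=
      ⟨fun g hg => hV.2 g (Multiset.mem_toFinset.mp hg), fun h' => hne (Finset.Subset.antisymm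
        (fun g hg => hV.2 g (Multiset.mem_toFinset.mp hg)) h')⟩
    have := Finset.card_lt_card hss
    exact hmin V.toFinset.card (by omega) ⟨V, rfl, hsub V hV, h⟩
  · exact ⟨hA.1, fun g hg => Multiset.mem_toFinset.mpr hg⟩

end StepTwo

/-! ### The invariant -/

/-- Arbitrarily long sets of lengths contained in a residue class modulo `d` and with elasticity
at least `(d + 2) / 2`. -/
def LongL (G : Type*) [AddCommGroup G] (d : ℕ) : Prop :=
  ∀ K : ℕ, ∃ L ∈ systemL (Set.univ : Set G), (∀ x ∈ L, ∀ y ∈ L, x ≡ y [MOD d]) ∧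
    ∃ x ∈ L, ∃ y ∈ L, K ≤ x ∧ (d + 2) * x ≤ 2 * y

section StepThree

variable {G : Type*} [AddCommGroup G]

lemma mem_lengthSet {B : Multiset G} {k : ℕ} : k ∈ lengthSet (Set.univ : Set G) B ↔
    ∃ s : Multiset (Multiset G), (∀ U ∈ s, IsMinZeroSum (Set.univ : Set G) U) ∧
      s.sum = B ∧ s.card = k := by
  constructor
  · rintro ⟨U, hU, hB⟩
    refine ⟨Finset.univ.val.map U, ?_, hB.symm, by simp⟩
    intro V hV
    obtain ⟨i, -, rfl⟩ := Multiset.mem_map.mp hV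
    exact hU i
  · rintro ⟨s, hs, hB, hk⟩
    induction s using Quotient.inductionOn with
    | h l =>
      have hk' : l.length = k := by simpa using hk
      subst hk'
      refine ⟨fun i => l[i], fun i => hs _ (by simp), ?_⟩
      rw [← hB]
      simp

variable [Finite G]

lemma pd_of_large (d : ℕ) : ∃ N : ℕ, ∀ B : Multiset G, B.sum = 0 →
    (∀ x ∈ lengthSet (Set.univ : Set G) B, ∀ y ∈ lengthSet (Set.univ : Set G) B,
      x ≡ y [MOD d]) → ∀ F : Finset G, (∀ g ∈ F, N ≤ B.count g) → PD d F := by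
  have := Fintype.ofFinite G
  have h1 : ∀ F : Finset G, ∃ n : ℕ, PD d F ∨ ∃ s s' : Multiset (Multiset G),
      (∀ U ∈ s, AtF F U) ∧ (∀ U ∈ s', AtF F U) ∧ s.sum = s'.sum ∧ s.sum.card ≤ n ∧
      ¬ s.card ≡ s'.card [MOD d] := by
    intro F
    by_cases h : PD d F
    · exact ⟨0, Or.inl h⟩
    · unfold PD at h
      push Not at h
      obtain ⟨s, s', hs, hs', he, hn⟩ := h
      exact ⟨s.sum.card, Or.inr ⟨s, s', hs, hs', he, le_rfl, hn⟩⟩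
  choose n hn using h1
  refine ⟨∑ F, n F, ?_⟩
  intro B hB hcong F hF
  rcases hn F with h | ⟨s, s', hs, hs', he, hc, hne⟩
  · exact h
  exfalso
  have hnF : n F ≤ ∑ F, n F := Finset.single_le_sum (fun _ _ => Nat.zero_le _) (Finset.mem_univ F)
  have hle : s.sum ≤ B := by
    rw [Multiset.le_iff_count]
    intro g
    by_cases hg : g ∈ s.sum
    · have h2 := hF g (mem_of_fac hs g hg)
      have h3 := Multiset.count_le_card g s.sum
      omega
    · rw [Multiset.count_eq_zero_of_notMem hg]; omega
  obtain ⟨t, ht, hts⟩ := fac_exists (F := Finset.univ) (C := B - s.sum)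
    (sum_sub_zero hle (sum_msum s (fun U hU => (hs U hU).1.2.2.1)) hB) (by simp)
  have hB' : t.sum + s.sum = B := by rw [hts]; exact tsub_add_cancel_of_le hle
  have h4 : (t + s).card ∈ lengthSet (Set.univ : Set G) B := by
    rw [mem_lengthSet]
    refine ⟨t + s, ?_, by simpa using hB', rfl⟩
    intro U hU
    rcases Multiset.mem_add.mp hU with h | h
    · exact (ht U h).1
    · exact (hs U h).1
  have h5 : (t + s').card ∈ lengthSet (Set.univ : Set G) B := by
    rw [mem_lengthSet]
    refine ⟨t + s', ?_, by rw [he] at hB'; simpa using hB', rfl⟩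
    intro U hU
    rcases Multiset.mem_add.mp hU with h | h
    · exact (ht U h).1
    · exact (hs' U h).1
  have h6 := hcong _ h4 _ h5
  rw [Multiset.card_add, Multiset.card_add] at h6
  exact hne (Nat.ModEq.add_left_cancel' _ h6)

/-- The number of terms outside `F`. -/
noncomputable def outC (F : Finset G) (S : Multiset G) : ℕ := S.countP (fun g => g ∉ F)

lemma outC_pos {F : Finset G} {U : Multiset G} (hU : IsMinZeroSum (Set.univ : Set G) U)
    (h : ¬ AtF F U) : 1 ≤ outC F U := by
  have : ∃ g ∈ U, g ∉ F := by
    by_contra hcon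
    push Not at hcon
    exact h ⟨hU, hcon⟩
  exact Multiset.countP_pos.mpr this

lemma kap_upper {F : Finset G} {m W : ℕ} (h1 : ∀ U, AtF F U → kap U ≤ m)
    (h2 : ∀ U : Multiset G, IsMinZeroSum (Set.univ : Set G) U → kap U ≤ W)
    (s : Multiset (Multiset G)) : (∀ U ∈ s, IsMinZeroSum (Set.univ : Set G) U) →
    kap s.sum ≤ m * s.card + W * outC F s.sum := by
  induction s using Multiset.induction_on with
  | empty => intro _; simp [kap_zero]
  | cons U s ih =>
    intro hs
    have h3 := ih (fun V hV => hs V (by simp [hV]))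
    have hU := hs U (by simp)
    have h4 : kap U ≤ m + W * outC F U := by
      by_cases h : AtF F U
      · exact (h1 U h).trans (Nat.le_add_right _ _)
      · have h5 := outC_pos hU h
        have := h2 U hU
        nlinarith
    have h5 : outC F (U + s.sum) = outC F U + outC F s.sum := Multiset.countP_add _ _ _
    rw [Multiset.sum_cons, kap_add, h5, Multiset.card_cons, mul_add, mul_add]
    omega

lemma kap_lower {F : Finset G} {q : ℕ} (h1 : ∀ U, AtF F U → q ≤ kap U)
    (s : Multiset (Multiset G)) : (∀ U ∈ s, IsMinZeroSum (Set.univ : Set G) U) →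
    q * s.card ≤ kap s.sum + q * outC F s.sum := by
  induction s using Multiset.induction_on with
  | empty => intro _; simp
  | cons U s ih =>
    intro hs
    have h3 := ih (fun V hV => hs V (by simp [hV]))
    have hU := hs U (by simp)
    have h4 : q ≤ kap U + q * outC F U := by
      by_cases h : AtF F U
      · exact (h1 U h).trans (Nat.le_add_right _ _)
      · have h5 := outC_pos hU h
        nlinarith
    have h5 : outC F (U + s.sum) = outC F U + outC F s.sum := Multiset.countP_add _ _ _
    rw [Multiset.sum_cons, kap_add, h5, Multiset.card_cons, mul_add, mul_add]
    omega

lemma card_le_of_count {N : ℕ} (S : Multiset G) (h : ∀ g, S.count g ≤ N) :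
    S.card ≤ Nat.card G * N := by
  have := Fintype.ofFinite G
  rw [← Multiset.sum_count_eq_card (s := Finset.univ) (m := S) (by simp)]
  calc ∑ a, S.count a ≤ ∑ _a : G, N := Finset.sum_le_sum (fun g _ => h g)
    _ = Nat.card G * N := by simp

lemma outC_le {F : Finset G} {N : ℕ} (S : Multiset G) (h : ∀ g, g ∉ F → S.count g ≤ N) :
    outC F S ≤ Nat.card G * N := by
  rw [outC, Multiset.countP_eq_card_filter]
  apply card_le_of_count
  intro g
  by_cases hg : g ∈ F
  · rw [Multiset.count_eq_zero_of_notMem (by simp [hg])]; omega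
  · exact (Multiset.count_le_of_le _ (Multiset.filter_le _ _)).trans (h g hg)

lemma not_longL {d r : ℕ} (hd : 1 ≤ d) (hm1 : 1 < AddMonoid.exponent G)
    (hm : AddMonoid.exponent G ≤ 2 * d + 1) (hrd : r ≤ d) (hrk : RkLe G r)
    (hne : d + 2 ≠ AddMonoid.exponent G) : ¬ LongL G d := by
  intro hQ
  obtain ⟨N, hN⟩ := pd_of_large (G := G) d
  set m := AddMonoid.exponent G with hmdef
  set W := m * (Nat.card G * m) with hW
  set C := Nat.card G * N with hC
  obtain ⟨L, ⟨B, hB, rfl⟩, hcong, x, hx, y, hy, hKx, hxy⟩ := hQ (2 * ((W + m) * C) + 1)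
  have := Fintype.ofFinite G
  let F : Finset G := Finset.univ.filter (fun g => N ≤ B.count g)
  have hPD : PD d F := hN B hB.2 hcong F (fun g hg => by simpa [F] using hg)
  have hup : ∀ U, AtF F U → kap U ≤ m := fun U hU => step2 hd hm1 hm hrd hrk hPD U hU
  have hWb : ∀ U : Multiset G, IsMinZeroSum (Set.univ : Set G) U → kap U ≤ W := by
    intro U hU
    refine (kap_le U).trans (Nat.mul_le_mul_left _ (card_le_of_count U (fun g => ?_)))
    exact (atom_count_le hU g).trans (ord_le g)
  have hq : ∃ q, q ≤ m ∧ 2 * m + 1 ≤ q * (d + 2) ∧ ∀ U, AtF F U → q ≤ kap U := by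
    by_cases h : ∃ U, AtF F U ∧ kap U < m
    · obtain ⟨U, hU, hUk⟩ := h
      have h1 := step1a hm1 hm hPD hU hUk
      have h2 := atom_kap_ne_one hm1 hU.1
      refine ⟨kap U, by omega, ?_, ?_⟩
      · have : 3 ≤ kap U := by omega
        rw [← hmdef] at h1
        nlinarith
      · intro V hV
        rcases Nat.lt_or_ge (kap V) m with h' | h'
        · have := step1a hm1 hm hPD hV h'
          omega
        · omega
    · push Not at h
      exact ⟨m, le_rfl, by nlinarith, h⟩
  obtain ⟨q, hqm, hqd, hql⟩ := hq
  obtain ⟨s, hs, hsB, rfl⟩ := mem_lengthSet.mp hx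
  obtain ⟨t, ht, htB, rfl⟩ := mem_lengthSet.mp hy
  have h1 := kap_upper hup hWb s hs
  have h2 := kap_lower hql t ht
  rw [hsB] at h1
  rw [htB] at h2
  have h3 : outC F B ≤ C := outC_le B (fun g hg => by
    have : ¬ N ≤ B.count g := by simpa [F] using hg
    omega)
  have h4 : (W + q) * outC F B ≤ (W + m) * C := Nat.mul_le_mul (by omega) h3
  have h5 : q * t.card ≤ m * s.card + (W + m) * C := by
    rw [add_mul] at h4
    omega
  have h6 : q * ((d + 2) * s.card) ≤ q * (2 * t.card) := Nat.mul_le_mul_left _ hxy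
  have h7 : (2 * m + 1) * s.card ≤ q * (d + 2) * s.card := Nat.mul_le_mul_right _ hqd
  nlinarith

end StepThree

/-! ### Constructions -/

section Constructions

variable {G : Type*} [AddCommGroup G]

lemma cong_of_weight {F : Finset G} {ω : G → ℕ} {P d : ℕ} (hP : 0 < P)
    (hat : ∀ U, AtF F U → (U.map ω).sum ≡ P [MOD P * d]) {B : Multiset G}
    (hB : ∀ g ∈ B, g ∈ F) : ∀ x ∈ lengthSet (Set.univ : Set G) B,
      ∀ y ∈ lengthSet (Set.univ : Set G) B, x ≡ y [MOD d] := by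
  have key : ∀ s : Multiset (Multiset G), (∀ U ∈ s, AtF F U) →
      (s.sum.map ω).sum ≡ P * s.card [MOD P * d] := by
    intro s
    induction s using Multiset.induction_on with
    | empty => intro _; simp [Nat.ModEq.refl]
    | cons U s ih =>
      intro hs
      have h1 := ih (fun V hV => hs V (by simp [hV]))
      have h2 := hat U (hs U (by simp))
      rw [Multiset.sum_cons, Multiset.map_add, Multiset.sum_add, Multiset.card_cons, mul_add,
        mul_one, add_comm]
      exact h1.add h2
  have hsub : ∀ s : Multiset (Multiset G), (∀ U ∈ s, IsMinZeroSum (Set.univ : Set G) U) →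
      s.sum = B → ∀ U ∈ s, AtF F U := by
    intro s hs hsB U hU
    exact ⟨hs U hU, fun g hg => hB g (hsB ▸ Multiset.mem_of_le (le_msum hU) hg)⟩
  intro x hx y hy
  obtain ⟨s, hs, hsB, rfl⟩ := mem_lengthSet.mp hx
  obtain ⟨t, ht, htB, rfl⟩ := mem_lengthSet.mp hy
  have h1 := key s (hsub s hs hsB)
  have h2 := key t (hsub t ht htB)
  rw [hsB] at h1
  rw [htB] at h2
  exact Nat.ModEq.mul_left_cancel' hP.ne' (h1.symm.trans h2)

variable [Finite G]

lemma replicate_atom {g : G} {U : Multiset G} (hU : IsMinZeroSum (Set.univ : Set G) U)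
    (h : ∀ x ∈ U, x = g) : U = OrdSeq g := by
  have h1 : U = Multiset.replicate U.card g := Multiset.eq_replicate_card.mpr h
  have h2 := hU.2.2.1
  rw [h1, Multiset.sum_replicate] at h2
  have h3 := addOrderOf_dvd_of_nsmul_eq_zero h2
  have h4 := Nat.le_of_dvd (Multiset.card_pos.mpr hU.1) h3
  apply atom_eq_rep hU
  rw [h1, Multiset.count_replicate_self]
  exact h4

lemma longL_exp (hm : 3 ≤ AddMonoid.exponent G) : LongL G (AddMonoid.exponent G - 2) := by
  obtain ⟨g, hg⟩ := AddMonoid.exists_addOrderOf_eq_exponent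
    (AddMonoid.ExponentExists.of_finite (G := G))
  have hg' : addOrderOf (-g) = AddMonoid.exponent G := by rw [addOrderOf_neg, hg]
  set m := AddMonoid.exponent G with hmdef
  have hne : g ≠ -g := by
    intro h
    have h1 : 2 • g = 0 := by rw [two_nsmul]; nth_rewrite 1 [h]; simp
    have h2 := Nat.le_of_dvd (by omega) (addOrderOf_dvd_of_nsmul_eq_zero h1)
    omega
  have hg0 : g ≠ 0 := by
    rintro rfl
    simp at hne
  have hpair : IsMinZeroSum (Set.univ : Set G) ({g, -g} : Multiset G) := by
    refine ⟨by simp, fun _ _ => Set.mem_univ _, by simp, fun T hT hT0 => ?_⟩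
    have hc := Multiset.card_le_card hT
    have h2 : Multiset.card ({g, -g} : Multiset G) = 2 := by simp
    rw [h2] at hc
    by_cases hc2 : T.card = 2
    · right; exact Multiset.eq_of_le_of_card_le hT (by omega)
    by_cases hc0 : T.card = 0
    · left; exact Multiset.card_eq_zero.mp hc0
    exfalso
    obtain ⟨x, rfl⟩ := Multiset.card_eq_one.mp (show T.card = 1 by omega)
    have hx : x ∈ ({g, -g} : Multiset G) := Multiset.mem_of_le hT (by simp)
    rw [Multiset.sum_singleton] at hT0
    subst hT0
    simp [hg0, eq_comm] at hx
  intro K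
  set B : Multiset G := K • (OrdSeq g + OrdSeq (-g)) with hB
  have hBF : ∀ x ∈ B, x ∈ ({g, -g} : Finset G) := by
    intro x hx
    have := Multiset.mem_of_mem_nsmul hx
    rcases Multiset.mem_add.mp this with h | h
    · rw [mem_rep.mp h]; simp
    · rw [mem_rep.mp h]; simp
  have hB0 : B.sum = 0 := by
    rw [hB, Multiset.sum_nsmul, Multiset.sum_add, rep_sum, rep_sum, add_zero, smul_zero]
  refine ⟨_, ⟨B, ⟨fun _ _ => Set.mem_univ _, hB0⟩, rfl⟩, ?_, 2 * K, ?_, m * K, ?_, by omega, ?_⟩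
  · apply cong_of_weight (F := {g, -g}) (ω := fun x => if x = g then 1 else m - 1) (P := m)
      (by omega) _ hBF
    intro U hU
    have hmem : ∀ x ∈ U, x = g ∨ x = -g := fun x hx => by simpa using hU.2 x hx
    by_cases h1 : g ∈ U
    · by_cases h2 : -g ∈ U
      · have hle : ({g, -g} : Multiset G) ≤ U := by
          rw [Multiset.le_iff_subset (by simp [hne])]
          intro x hx
          simp only [Multiset.insert_eq_cons, Multiset.mem_cons, Multiset.mem_singleton] at hx
          rcases hx with h | h
          · rw [h]; exact h1
          · rw [h]; exact h2
        rw [← atom_self hU.1 hpair.2.2.1 hpair.1 hle]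
        simp only [Multiset.insert_eq_cons, Multiset.map_cons, Multiset.map_singleton,
          Multiset.sum_cons, Multiset.sum_singleton, if_true, if_neg hne.symm]
        rw [show 1 + (m - 1) = m by omega]
      · have := replicate_atom (g := g) hU.1 (fun x hx => (hmem x hx).resolve_right
          (fun h => h2 (h ▸ hx)))
        rw [this, OrdSeq, hg]
        simp only [Multiset.map_replicate, if_true, Multiset.sum_replicate, smul_eq_mul, mul_one]
        exact Nat.ModEq.refl _
    · have := replicate_atom (g := -g) hU.1 (fun x hx => (hmem x hx).resolve_left
          (fun h => h1 (h ▸ hx)))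
      rw [this, OrdSeq, hg']
      simp only [Multiset.map_replicate, if_neg hne.symm, Multiset.sum_replicate, smul_eq_mul]
      have : m * (m - 1) = m + m * (m - 2) := by
        obtain ⟨k, hk⟩ : ∃ k, m = k + 2 := ⟨m - 2, by omega⟩
        rw [hk]
        simp only [Nat.add_sub_cancel, show k + 2 - 1 = k + 1 by omega]
        ring
      rw [this]
      exact Nat.add_modEq_right
  · rw [mem_lengthSet]
    refine ⟨Multiset.replicate K (OrdSeq g) + Multiset.replicate K (OrdSeq (-g)), ?_, ?_, ?_⟩
    · intro U hU
      rcases Multiset.mem_add.mp hU with h | h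
      · rw [Multiset.eq_of_mem_replicate h]; exact rep_atom _
      · rw [Multiset.eq_of_mem_replicate h]; exact rep_atom _
    · rw [Multiset.sum_add, Multiset.sum_replicate, Multiset.sum_replicate, hB, nsmul_add]
    · simp; ring
  · rw [mem_lengthSet]
    refine ⟨Multiset.replicate (m * K) {g, -g}, ?_, ?_, by simp⟩
    · intro U hU
      rw [Multiset.eq_of_mem_replicate hU]; exact hpair
    · rw [Multiset.sum_replicate, hB, mul_comm, mul_nsmul', OrdSeq, OrdSeq, hg, hg',
        Multiset.insert_eq_cons, ← Multiset.singleton_add, nsmul_add, Multiset.nsmul_singleton,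
        Multiset.nsmul_singleton]
  · rw [show m - 2 + 2 = m by omega]
    apply le_of_eq; ring

lemma longL_indep {s p : ℕ} (hs : 2 ≤ s) (hp : p.Prime) (e : Fin s → G)
    (he : ∀ c : Fin s → ℕ, ∑ i, c i • e i = 0 ↔ ∀ i, p ∣ c i) : LongL G (s - 1) := by
  have hp2 := hp.two_le
  have hpe : ∀ i, p • e i = 0 := by
    intro i
    have := (he (Pi.single i p)).mpr (fun j => by
      by_cases h : j = i
      · subst h; simp
      · simp [h])
    simpa [Pi.single_apply, ite_smul] using this
  have hdvd : ∀ i k, k • e i = 0 → p ∣ k := by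
    intro i k hk
    have := (he (Pi.single i k)).mp (by simpa [Pi.single_apply, ite_smul] using hk) i
    simpa using this
  set f := ∑ i, e i with hf
  have hinj : Function.Injective e := by
    intro i j hij
    by_contra hne
    have h1 := (he (fun k => if k = i then 1 else if k = j then p - 1 else 0)).mp (by
      have : ∀ k, (if k = i then 1 else if k = j then p - 1 else 0) • e k =
          (if k = i then e i else 0) + (if k = j then (p - 1) • e j else 0) := by
        intro k
        by_cases h1 : k = i
        · subst h1; simp [hne]
        · by_cases h2 : k = j
          · subst h2; simp [h1]
          · simp [h1, h2]
      simp only [this, Finset.sum_add_distrib, Finset.sum_ite_eq', Finset.mem_univ, if_true]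
      rw [hij, ← succ_nsmul', show p - 1 + 1 = p by omega, hpe]) i
    simp only [if_true] at h1
    exact hp.one_lt.ne' (Nat.dvd_one.mp h1)
  have hfe : ∀ i, f ≠ e i := by
    intro i h
    obtain ⟨j, hj⟩ : ∃ j : Fin s, j ≠ i := by
      have : Nontrivial (Fin s) := Fin.nontrivial_iff_two_le.mpr hs
      exact exists_ne i
    have h1 := (he (fun k => 1 + if k = i then p - 1 else 0)).mp (by
      simp only [add_smul, one_smul, Finset.sum_add_distrib, ite_smul, zero_smul,
        Finset.sum_ite_eq', Finset.mem_univ, if_true]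
      rw [← hf, h, ← succ_nsmul', show p - 1 + 1 = p by omega, hpe]) j
    simp only [if_neg hj, add_zero] at h1
    exact hp.one_lt.ne' (Nat.dvd_one.mp h1)
  have hef : ∀ i, e i ≠ f := fun i => (hfe i).symm
  have hoe : ∀ i, addOrderOf (e i) = p := fun i =>
    Nat.dvd_antisymm (addOrderOf_dvd_of_nsmul_eq_zero (hpe i))
      (hdvd i _ (addOrderOf_nsmul_eq_zero _))
  have hof : addOrderOf f = p := by
    apply Nat.dvd_antisymm
    · apply addOrderOf_dvd_of_nsmul_eq_zero
      rw [hf, Finset.smul_sum]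
      exact Finset.sum_eq_zero (fun i _ => hpe i)
    · have := addOrderOf_nsmul_eq_zero f
      rw [hf, Finset.smul_sum, ← hf] at this
      exact (he (fun _ => addOrderOf f)).mp this ⟨0, by omega⟩
  let mk : ℕ → (Fin s → ℕ) → Multiset G := fun j c =>
    Multiset.replicate j f + ∑ i, Multiset.replicate (c i) (e i)
  let F : Finset G := insert f (Finset.univ.image e)
  have hF : ∀ x, x ∈ F ↔ x = f ∨ ∃ i, e i = x := by
    intro x; simp [F]
  have mk_f : ∀ j c, (mk j c).count f = j := by
    intro j c
    simp [mk, Multiset.count_add, Multiset.count_sum', Multiset.count_replicate, hef]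
  have mk_e : ∀ j c i, (mk j c).count (e i) = c i := by
    intro j c i
    simp [mk, Multiset.count_add, Multiset.count_sum', Multiset.count_replicate, hfe,
      hinj.eq_iff]
  have mk_F : ∀ j c, ∀ x ∈ mk j c, x ∈ F := by
    intro j c x hx
    rw [hF]
    rcases Multiset.mem_add.mp hx with h | h
    · exact Or.inl (Multiset.eq_of_mem_replicate h)
    · obtain ⟨i, -, hi⟩ := Multiset.mem_sum.mp h
      exact Or.inr ⟨i, (Multiset.eq_of_mem_replicate hi).symm⟩
  have ext_F : ∀ U V : Multiset G, (∀ x ∈ U, x ∈ F) → (∀ x ∈ V, x ∈ F) →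
      U.count f = V.count f → (∀ i, U.count (e i) = V.count (e i)) → U = V := by
    intro U V hU hV h1 h2
    ext x
    by_cases hx : x ∈ F
    · rcases (hF x).mp hx with h | ⟨i, h⟩
      · rw [h, h1]
      · rw [← h, h2]
    · rw [Multiset.count_eq_zero_of_notMem (fun h => hx (hU x h)),
        Multiset.count_eq_zero_of_notMem (fun h => hx (hV x h))]
  have eq_mk : ∀ U : Multiset G, (∀ x ∈ U, x ∈ F) →
      U = mk (U.count f) (fun i => U.count (e i)) := by
    intro U hU
    refine ext_F _ _ hU (mk_F _ _) (mk_f _ _).symm (fun i => ?_)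
    rw [mk_e]
  have mk_sum : ∀ j c, (mk j c).sum = ∑ i, (j + c i) • e i := by
    intro j c
    have : (∑ i, Multiset.replicate (c i) (e i)).sum = ∑ i, c i • e i := by
      rw [← Multiset.coe_sumAddMonoidHom, map_sum]
      simp
    simp only [mk, Multiset.sum_add, this, Multiset.sum_replicate, add_smul,
      Finset.sum_add_distrib, hf, Finset.smul_sum]
  have zs_iff : ∀ j c, (mk j c).sum = 0 ↔ ∀ i, p ∣ j + c i := by
    intro j c
    rw [mk_sum]
    exact he (fun i => j + c i)
  have mk_w : ∀ j c, ((mk j c).map (fun x => if x = f then s else 1)).sum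
      = j * s + ∑ i, c i := by
    intro j c
    have : ((∑ i, Multiset.replicate (c i) (e i)).map (fun x => if x = f then s else 1)).sum
        = ∑ i, c i := by
      rw [← Multiset.coe_mapAddMonoidHom, map_sum, ← Multiset.coe_sumAddMonoidHom, map_sum]
      simp [hef]
    simp only [mk, Multiset.map_add, Multiset.sum_add, this]
    simp
  have mk_add : ∀ j c j' c', mk j c + mk j' c' = mk (j + j') (fun i => c i + c' i) := by
    intro j c j' c'
    apply ext_F
    · intro x hx
      rcases Multiset.mem_add.mp hx with h | h
      · exact mk_F _ _ x h
      · exact mk_F _ _ x h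
    · exact mk_F _ _
    · rw [Multiset.count_add, mk_f, mk_f, mk_f]
    · intro i; rw [Multiset.count_add, mk_e, mk_e, mk_e]
  have i0 : Fin s := ⟨0, by omega⟩
  have hA : IsMinZeroSum (Set.univ : Set G) (mk 1 (fun _ => p - 1)) := by
    refine ⟨?_, fun _ _ => Set.mem_univ _, ?_, ?_⟩
    · intro h
      have := mk_f 1 (fun _ => p - 1)
      rw [h] at this
      simp at this
    · rw [zs_iff]
      intro i
      rw [show 1 + (p - 1) = p by omega]
    · intro T hT hT0
      have hTF : ∀ x ∈ T, x ∈ F := fun x hx => mk_F _ _ x (Multiset.mem_of_le hT hx)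
      have h1 : T.count f ≤ 1 := by
        have := Multiset.count_le_of_le f hT
        rwa [mk_f] at this
      have h2 : ∀ i, T.count (e i) ≤ p - 1 := fun i => by
        have := Multiset.count_le_of_le (e i) hT
        rwa [mk_e] at this
      rw [eq_mk T hTF, zs_iff] at hT0
      rcases Nat.lt_or_ge (T.count f) 1 with h | h
      · left
        have h3 : T.count f = 0 := by omega
        apply ext_F T 0 hTF (by simp) (by simpa using h3)
        intro i
        have h4 := hT0 i
        rw [h3, zero_add] at h4
        have := h2 i
        rw [Nat.eq_zero_of_dvd_of_lt h4 (by omega)]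
        simp
      · right
        have h3 : T.count f = 1 := by omega
        apply ext_F _ _ hTF (mk_F _ _)
        · rw [h3, mk_f]
        · intro i
          rw [mk_e]
          have h4 := hT0 i
          rw [h3] at h4
          have := Nat.le_of_dvd (by omega) h4
          have := h2 i
          omega
  intro K
  set B : Multiset G := (K * p) • mk 1 (fun _ => p - 1) with hB
  refine ⟨_, ⟨B, ⟨fun _ _ => Set.mem_univ _, ?_⟩, rfl⟩, ?_, K * p, ?_,
    K + s * (K * (p - 1)), ?_, ?_, ?_⟩
  · rw [hB, Multiset.sum_nsmul, hA.2.2.1, smul_zero]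
  · apply cong_of_weight (F := F) (ω := fun x => if x = f then s else 1) (P := p)
      (by omega)
    · intro U hU
      have hps : s * p = p + p * (s - 1) := by
        obtain ⟨k, hk⟩ : ∃ k, s = k + 1 := ⟨s - 1, by omega⟩
        rw [hk, Nat.add_sub_cancel]
        ring
      by_cases h1 : p ≤ U.count f
      · rw [atom_eq_rep hU.1 (by rw [hof]; exact h1), OrdSeq, hof]
        simp only [Multiset.map_replicate, if_true, Multiset.sum_replicate, smul_eq_mul]
        rw [mul_comm p s, hps]
        exact Nat.add_modEq_right
      by_cases h2 : ∃ i, p ≤ U.count (e i)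
      · obtain ⟨i, h2⟩ := h2
        rw [atom_eq_rep hU.1 (by rw [hoe]; exact h2), OrdSeq, hoe]
        simp only [Multiset.map_replicate, if_neg (hef i), Multiset.sum_replicate, smul_eq_mul,
          mul_one]
        exact Nat.ModEq.refl _
      push Not at h1 h2
      have h3 := hU.1.2.2.1
      rw [eq_mk U hU.2, zs_iff] at h3
      have hj : U.count f ≠ 0 := by
        intro hj
        apply hU.1.1
        apply ext_F U 0 hU.2 (by simp) (by simpa using hj)
        intro i
        have h4 := h3 i
        rw [hj, zero_add] at h4
        rw [Nat.eq_zero_of_dvd_of_lt h4 (h2 i)]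
        simp
      have h4 : ∀ i, U.count (e i) = p - U.count f := by
        intro i
        obtain ⟨c, hc⟩ := h3 i
        have := h2 i
        have : c = 1 := by
          have h5 : c ≠ 0 := by rintro rfl; omega
          have h6 : c < 2 := by
            by_contra h
            have := Nat.mul_le_mul_left p (show 2 ≤ c by omega)
            omega
          omega
        subst this
        omega
      rw [eq_mk U hU.2, mk_w]
      simp only [h4, Finset.sum_const, Finset.card_univ, Fintype.card_fin, smul_eq_mul]
      rw [mul_comm _ s, ← mul_add, show U.count f + (p - U.count f) = p by omega, hps]
      exact Nat.add_modEq_right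
    · intro x hx
      exact mk_F _ _ x (Multiset.mem_of_mem_nsmul hx)
  · rw [mem_lengthSet]
    refine ⟨Multiset.replicate (K * p) (mk 1 (fun _ => p - 1)), ?_, ?_, by simp⟩
    · intro U hU
      rw [Multiset.eq_of_mem_replicate hU]; exact hA
    · rw [Multiset.sum_replicate]
  · rw [mem_lengthSet]
    refine ⟨Multiset.replicate K (OrdSeq f) +
      ∑ i, Multiset.replicate (K * (p - 1)) (OrdSeq (e i)), ?_, ?_, ?_⟩
    · intro U hU
      rcases Multiset.mem_add.mp hU with h | h
      · rw [Multiset.eq_of_mem_replicate h]; exact rep_atom _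
      · obtain ⟨i, -, hi⟩ := Multiset.mem_sum.mp h
        rw [Multiset.eq_of_mem_replicate hi]; exact rep_atom _
    · have h1 : (Multiset.replicate K (OrdSeq f) +
          ∑ i, Multiset.replicate (K * (p - 1)) (OrdSeq (e i))).sum
          = mk (K * p) (fun _ => K * (p - 1) * p) := by
        rw [Multiset.sum_add, ← Multiset.coe_sumAddMonoidHom, map_sum]
        simp only [Multiset.coe_sumAddMonoidHom, Multiset.sum_replicate, OrdSeq, hof, hoe,
          Multiset.nsmul_replicate, mk]
      rw [h1, hB]
      apply ext_F _ _ (mk_F _ _) (fun x hx => mk_F _ _ x (Multiset.mem_of_mem_nsmul hx))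
      · rw [mk_f, Multiset.count_nsmul, mk_f, mul_one]
      · intro i
        rw [mk_e, Multiset.count_nsmul, mk_e]
        ring
    · rw [Multiset.card_add, Multiset.card_sum]
      simp
  · nlinarith
  · obtain ⟨a, rfl⟩ : ∃ a, s = a + 2 := ⟨s - 2, by omega⟩
    obtain ⟨b, rfl⟩ : ∃ b, p = b + 2 := ⟨p - 2, by omega⟩
    rw [show a + 2 - 1 = a + 1 by omega, show b + 2 - 1 = b + 1 by omega]
    have : 0 ≤ K * (a * b) := Nat.zero_le _
    nlinarith [Nat.zero_le (K * b), Nat.zero_le (K * (a * b))]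

end Constructions

/-! ### Structure of finite abelian groups -/

section Structure

variable {G : Type*} [AddCommGroup G] [Finite G]

lemma exponent_eq_last {r : ℕ} (n : Fin r → ℕ) (l : Fin r) (hl : ∀ i, n i ∣ n l)
    (φ : G ≃+ (∀ i : Fin r, ZMod (n i))) : AddMonoid.exponent G = n l := by
  apply Nat.dvd_antisymm
  · apply AddMonoid.exponent_dvd_of_forall_nsmul_eq_zero
    intro x
    apply φ.injective
    rw [map_nsmul, map_zero]
    funext i
    rw [Pi.smul_apply, Pi.zero_apply, nsmul_eq_mul, (ZMod.natCast_eq_zero_iff _ _).mpr (hl i),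
      zero_mul]
  · have h := AddMonoid.exponent_nsmul_eq_zero (φ.symm (Pi.single l 1))
    have h1 := congrArg φ h
    rw [map_nsmul, map_zero, AddEquiv.apply_symm_apply] at h1
    have h2 := congrFun h1 l
    rw [Pi.smul_apply, Pi.single_eq_same, Pi.zero_apply, nsmul_eq_mul, mul_one] at h2
    exact (ZMod.natCast_eq_zero_iff _ _).mp h2

lemma rkLe_of_equiv {r : ℕ} (n : Fin r → ℕ) (hn : ∀ i, 1 < n i)
    (φ : G ≃+ (∀ i : Fin r, ZMod (n i))) : RkLe G r := by
  intro p hp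
  have : ∀ i, NeZero (n i) := fun i => ⟨by have := hn i; omega⟩
  have h1 : Nat.card {x : G // p • x = 0} ≤
      Nat.card (∀ i : Fin r, {y : ZMod (n i) // p • y = 0}) := by
    refine Nat.card_le_card_of_injective
      (fun x i => (⟨φ x.1 i, ?_⟩ : {y : ZMod (n i) // p • y = 0})) ?_
    · have := congrArg φ x.2
      rw [map_nsmul, map_zero] at this
      exact congrFun this i
    · intro x y h
      apply Subtype.ext
      apply φ.injective
      funext i
      exact congrArg Subtype.val (congrFun h i)
  refine h1.trans ?_
  rw [Nat.card_pi]
  calc ∏ i : Fin r, Nat.card {y : ZMod (n i) // p • y = 0} ≤ ∏ _i : Fin r, p := by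
        apply Finset.prod_le_prod'
        intro i _
        have := IsAddCyclic.card_nsmul_eq_zero_le (α := ZMod (n i)) (n := p) hp.pos
        rw [Nat.card_eq_fintype_card, Fintype.card_subtype]
        exact this
    _ = p ^ r := by simp

lemma longL_of_rank {r s : ℕ} (n : Fin r → ℕ) (hn : ∀ i, 1 < n i)
    (hdvd : ∀ i j : Fin r, i ≤ j → n i ∣ n j)
    (φ : G ≃+ (∀ i : Fin r, ZMod (n i))) (hs : 2 ≤ s) (hsr : s ≤ r) : LongL G (s - 1) := by
  obtain ⟨p, hp, hpn⟩ := Nat.exists_prime_and_dvd (hn ⟨0, by omega⟩).ne'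
  have hpi : ∀ i, p ∣ n i := fun i => hpn.trans (hdvd _ _ (Fin.mk_le_of_le_val (Nat.zero_le _)))
  let ι : Fin s → Fin r := Fin.castLE hsr
  have hι : Function.Injective ι := Fin.castLE_injective hsr
  have hz : ∀ (i : Fin r) (c : ℕ), c • ((n i / p : ℕ) : ZMod (n i)) = 0 ↔ p ∣ c := by
    intro i c
    rw [nsmul_eq_mul, ← Nat.cast_mul, ZMod.natCast_eq_zero_iff]
    have h1 : n i = p * (n i / p) := (Nat.mul_div_cancel' (hpi i)).symm
    have h2 : 0 < n i / p := Nat.div_pos (Nat.le_of_dvd (by have := hn i; omega) (hpi i)) hp.pos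
    conv_lhs => rw [h1]
    rw [Nat.mul_div_cancel_left _ hp.pos]
    exact Nat.mul_dvd_mul_iff_right h2
  apply longL_indep hs hp (fun i => φ.symm (Pi.single (ι i) ((n (ι i) / p : ℕ) : ZMod (n (ι i)))))
  intro c
  have h1 : (∑ i, c i • φ.symm (Pi.single (ι i) ((n (ι i) / p : ℕ) : ZMod (n (ι i)))) = 0) ↔
      (∑ i, c i • (Pi.single (ι i) ((n (ι i) / p : ℕ) : ZMod (n (ι i))) :
        ∀ i : Fin r, ZMod (n i)) = 0) := by
    rw [← map_eq_zero_iff φ.symm φ.symm.injective, map_sum]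
    simp only [map_nsmul]
  rw [h1]
  constructor
  · intro h i
    have h2 := congrFun h (ι i)
    rw [Finset.sum_apply, Finset.sum_eq_single i, Pi.smul_apply, Pi.single_eq_same,
      Pi.zero_apply, hz] at h2
    · exact h2
    · intro j _ hj
      rw [Pi.smul_apply, Pi.single_eq_of_ne (fun h => hj (hι h).symm), smul_zero]
    · simp
  · intro h
    apply Finset.sum_eq_zero
    intro i _
    rw [← Pi.single_smul, (hz _ _).mpr (h i), Pi.single_zero]

end Structure

/-- If `G ≅ C_{n₁} ⊕ … ⊕ C_{n_r}` with `1 < n₁ ∣ … ∣ n_r`,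
`D(G) ≥ 4`, `𝓛(G) = 𝓛(G')` and `⌊n_r/2⌋ + 1 ≤ r ≤ n_r − 3`, then
`exp(G) = exp(G')` and `r(G) = r(G')`. -/
theorem stmt5 {G G' : Type*} [AddCommGroup G] [Fintype G] [AddCommGroup G'] [Fintype G']
    (r : ℕ) (hr : 0 < r) (n : Fin r → ℕ) (hn : ∀ i, 1 < n i)
    (hdvd : ∀ i j : Fin r, i ≤ j → n i ∣ n j)
    (hG : Nonempty (G ≃+ (∀ i : Fin r, ZMod (n i))))
    (r' : ℕ) (hr' : 0 < r') (n' : Fin r' → ℕ) (hn' : ∀ i, 1 < n' i)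
    (hdvd' : ∀ i j : Fin r', i ≤ j → n' i ∣ n' j)
    (hG' : Nonempty (G' ≃+ (∀ i : Fin r', ZMod (n' i))))
    (hD : 4 ≤ davenport G)
    (hL : systemL (Set.univ : Set G) = systemL (Set.univ : Set G'))
    (hcond1 : n ⟨r - 1, by omega⟩ / 2 + 1 ≤ r) (hcond2 : r ≤ n ⟨r - 1, by omega⟩ - 3) :
    AddMonoid.exponent G = AddMonoid.exponent G' ∧ r = r' := by
  obtain ⟨φ⟩ := hG
  obtain ⟨φ'⟩ := hG'
  have hQ : ∀ d, LongL G d ↔ LongL G' d := by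
    intro d
    unfold LongL
    rw [hL]
  have hm := exponent_eq_last n ⟨r - 1, by omega⟩
    (fun i => hdvd _ _ (Fin.le_def.mpr (by have := i.2; simp only; omega))) φ
  have hm' := exponent_eq_last n' ⟨r' - 1, by omega⟩
    (fun i => hdvd' _ _ (Fin.le_def.mpr (by have := i.2; simp only; omega))) φ'
  have hm1' : 1 < AddMonoid.exponent G' := by rw [hm']; exact hn' _
  have hrk := rkLe_of_equiv n hn φ
  have hrk' := rkLe_of_equiv n' hn' φ'
  rw [← hm] at hcond1 hcond2
  have hm1 : 1 < AddMonoid.exponent G := by rw [hm]; exact hn _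
  clear hm hm' hD hL
  have hr2 : r' ≤ AddMonoid.exponent G - 2 := by
    by_contra hcon
    have h1 := longL_of_rank (s := AddMonoid.exponent G - 2) n' hn' hdvd' φ' (by omega) (by omega)
    exact not_longL (by omega) hm1 (by omega) (by omega) hrk (by omega) ((hQ _).mpr h1)
  have hmm : AddMonoid.exponent G = AddMonoid.exponent G' := by
    rcases Nat.lt_trichotomy (AddMonoid.exponent G) (AddMonoid.exponent G') with h | h | h
    · exfalso
      have h1 := longL_exp (G := G') (by omega)
      exact not_longL (by omega) hm1 (by omega) (by omega) hrk (by omega) ((hQ _).mpr h1)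
    · exact h
    · exfalso
      have h1 := longL_exp (G := G) (by omega)
      exact not_longL (by omega) hm1' (by omega) (by omega) hrk' (by omega) ((hQ _).mp h1)
  refine ⟨hmm, ?_⟩
  rcases Nat.lt_trichotomy r r' with h | h | h
  · exfalso
    have h1 := longL_of_rank (s := r') n' hn' hdvd' φ' (by omega) le_rfl
    exact not_longL (by omega) hm1 (by omega) (by omega) hrk (by omega) ((hQ _).mpr h1)
  · exact h
  · exfalso
    have h1 := longL_of_rank (s := r) n hn hdvd φ (by omega) le_rfl
    exact not_longL (by omega) hm1' (by omega) (by omega) hrk' (by omega) ((hQ _).mp h1)
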